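/- Fix a positive integer n. The Horn cone C_Horn is a closed convex cone in ℝ^{3n}: it is closed, convex (if (a,b,c) and (a',b',c') lie in C_Horn then so does (a+a', b+b', c+c') and every convex combination), and stable under multiplication by nonnegative scalars. -/

import Mathlib

open Matrix

/-- The eigenvalues of a Hermitian matrix, listed in decreasing order. -/
noncomputable def eigsDesc {n : ℕ} {A : Matrix (Fin n) (Fin n) ℂ} (hA : A.IsHermitian) :
    Fin n → ℝ :=
  fun i => hA.eigenvalues (Tuple.sort hA.eigenvalues i.rev)

/-- `lMap hA i = λ₁ + … + λ_{i+1}`, the partial sums of the decreasingly ordered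
eigenvalues of a Hermitian matrix (`i : Fin n` represents the index `i+1`). -/
noncomputable def lMap {n : ℕ} {A : Matrix (Fin n) (Fin n) ℂ} (hA : A.IsHermitian) :
    Fin n → ℝ :=
  fun i => ∑ j ∈ Finset.Iic i, eigsDesc hA j

/-- The Horn cone: triples `(a, b, c)` such that there are Hermitian matrices `K₁, K₂`
with `l(K₁) = a`, `l(K₂) = b`, `l(K₁ + K₂) = c`. -/
def HornCone (n : ℕ) : Set ((Fin n → ℝ) × (Fin n → ℝ) × (Fin n → ℝ)) :=
  {abc | ∃ (K₁ K₂ : Matrix (Fin n) (Fin n) ℂ) (h₁ : K₁.IsHermitian) (h₂ : K₂.IsHermitian),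
    lMap h₁ = abc.1 ∧ lMap h₂ = abc.2.1 ∧ lMap (h₁.add h₂) = abc.2.2}



section Alg
open Polynomial PrimeSpectrum

lemma constr_dich (Z : Set (PrimeSpectrum ℂ[X])) (hZ : Topology.IsConstructible Z) :
    (∃ f : ℂ[X], f ≠ 0 ∧ (basicOpen f : Set (PrimeSpectrum ℂ[X])) ⊆ Z) ∨
    (∃ f : ℂ[X], f ≠ 0 ∧ (basicOpen f : Set (PrimeSpectrum ℂ[X])) ⊆ Zᶜ) := by
  induction hZ using Topology.IsConstructible.empty_union_induction with
  | open_retrocompact U hU hc =>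
    rcases U.eq_empty_or_nonempty with h | ⟨x, hx⟩
    · right; exact ⟨1, one_ne_zero, by simp [h]⟩
    · left
      obtain ⟨_, ⟨f, rfl⟩, hf, hs⟩ := isTopologicalBasis_basic_opens.exists_subset_of_mem_open hx hU
      refine ⟨f, ?_, hs⟩
      rintro rfl
      simp at hf
  | union s hs t ht h1 h2 =>
    rcases h1 with ⟨f, hf, h⟩ | ⟨f, hf, h⟩
    · left; exact ⟨f, hf, h.trans Set.subset_union_left⟩
    · rcases h2 with ⟨g, hg, h'⟩ | ⟨g, hg, h'⟩
      · left; exact ⟨g, hg, h'.trans Set.subset_union_right⟩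
      · right
        refine ⟨f * g, mul_ne_zero hf hg, ?_⟩
        rw [basicOpen_mul, Set.compl_union]
        intro x hx
        exact ⟨h hx.1, h' hx.2⟩
  | compl s hs h =>
    rw [compl_compl]; exact h.symm

lemma alg_dich_aux (A : Type) [CommRing A] [Algebra ℂ[X] A] [Algebra.FiniteType ℂ[X] A] :
    {t : ℂ | ∃ φ : A →+* ℂ, ∀ f, φ (algebraMap ℂ[X] A f) = eval t f}.Finite ∨
    {t : ℂ | ∃ φ : A →+* ℂ, ∀ f, φ (algebraMap ℂ[X] A f) = eval t f}ᶜ.Finite := by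
  set T := {t : ℂ | ∃ φ : A →+* ℂ, ∀ f, φ (algebraMap ℂ[X] A f) = eval t f} with hT
  have hfp : Algebra.FinitePresentation ℂ[X] A :=
    (Algebra.FinitePresentation.of_finiteType (R := ℂ[X]) (A := A)).mp inferInstance
  have hc := isConstructible_range_comap (RingHom.finitePresentation_algebraMap.mpr hfp)
  have hpr : ∀ t : ℂ, (RingHom.ker (evalRingHom t)).IsPrime := fun t => RingHom.ker_isPrime _
  have key : ∀ t : ℂ, t ∈ T ↔ (⟨RingHom.ker (evalRingHom t), hpr t⟩ : PrimeSpectrum ℂ[X]) ∈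
      Set.range (comap (algebraMap ℂ[X] A)) := by
    intro t
    constructor
    · rintro ⟨φ, hφ⟩
      refine ⟨⟨RingHom.ker φ, RingHom.ker_isPrime _⟩, ?_⟩
      ext f
      simp [RingHom.mem_ker, hφ]
    · rintro ⟨p, hp⟩
      have hp' : ∀ f, algebraMap ℂ[X] A f ∈ p.asIdeal ↔ eval t f = 0 := by
        intro f
        have := congrArg (fun q : PrimeSpectrum ℂ[X] => f ∈ q.asIdeal) hp
        simpa [RingHom.mem_ker] using this
      obtain ⟨m, hm, hpm⟩ := Ideal.exists_le_maximal p.asIdeal p.2.ne_top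
      let : Algebra ℂ A := ((algebraMap ℂ[X] A).comp C).toAlgebra
      have : IsScalarTower ℂ ℂ[X] A := IsScalarTower.of_algebraMap_eq (fun _ => rfl)
      let : Field (A ⧸ m) := Ideal.Quotient.field m
      have : Algebra.FiniteType ℂ A := Algebra.FiniteType.trans (S := ℂ[X]) inferInstance inferInstance
      have : Algebra.FiniteType ℂ (A ⧸ m) := inferInstance
      have := finite_of_finite_type_of_isJacobsonRing ℂ (A ⧸ m)
      have hb := IsAlgClosed.algebraMap_bijective_of_isIntegral (k := ℂ) (K := A ⧸ m)
      let e := RingEquiv.ofBijective (algebraMap ℂ (A ⧸ m)) hb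
      refine ⟨(e.symm : (A ⧸ m) →+* ℂ).comp (Ideal.Quotient.mk m), fun f => ?_⟩
      have h1 : algebraMap ℂ[X] A (f - C (eval t f)) ∈ m := hpm ((hp' _).2 (by simp))
      have h2 : (Ideal.Quotient.mk m) (algebraMap ℂ[X] A f) = algebraMap ℂ (A ⧸ m) (eval t f) := by
        rw [map_sub] at h1
        rw [Ideal.Quotient.eq.2 h1]
        rfl
      change e.symm ((Ideal.Quotient.mk m) (algebraMap ℂ[X] A f)) = _
      rw [h2]
      exact e.symm_apply_apply _
  rcases constr_dich _ hc with ⟨f, hf, h⟩ | ⟨f, hf, h⟩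
  · right
    refine (Polynomial.finite_setOfPred_isRoot hf).subset ?_
    intro t ht
    by_contra hr
    apply ht
    rw [key]
    apply h
    simpa [mem_basicOpen, RingHom.mem_ker] using hr
  · left
    refine (Polynomial.finite_setOfPred_isRoot hf).subset ?_
    intro t ht
    by_contra hr
    refine h (a := ⟨RingHom.ker (evalRingHom t), hpr t⟩) ?_ ((key t).1 ht)
    simpa [mem_basicOpen, RingHom.mem_ker] using hr

lemma alg_dich {σ : Type} [Finite σ] (S : Set (MvPolynomial σ ℂ[X])) :
    {t : ℂ | ∃ x : σ → ℂ, ∀ p ∈ S, MvPolynomial.eval₂ (evalRingHom t) x p = 0}.Finite ∨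
    {t : ℂ | ∃ x : σ → ℂ, ∀ p ∈ S, MvPolynomial.eval₂ (evalRingHom t) x p = 0}ᶜ.Finite := by
  convert! alg_dich_aux (MvPolynomial σ ℂ[X] ⧸ Ideal.span S) using 3
  all_goals
    ext t
    constructor
    · rintro ⟨x, hx⟩
      refine ⟨Ideal.Quotient.lift (Ideal.span S)
        (MvPolynomial.eval₂Hom (evalRingHom t) x) (by
          intro a ha
          have : Ideal.span S ≤ RingHom.ker (MvPolynomial.eval₂Hom (evalRingHom t) x) :=
            Ideal.span_le.mpr (fun p hp => hx p hp)
          exact this ha), fun f => ?_⟩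
      change MvPolynomial.eval₂Hom (evalRingHom t) x (MvPolynomial.C f) = _
      simp
    · rintro ⟨φ, hφ⟩
      refine ⟨fun i => φ (Ideal.Quotient.mk _ (MvPolynomial.X i)), fun q hq => ?_⟩
      have h1 : φ.comp (Ideal.Quotient.mk _) = MvPolynomial.eval₂Hom (evalRingHom t)
          (fun i => φ (Ideal.Quotient.mk _ (MvPolynomial.X i))) := by
        apply MvPolynomial.ringHom_ext
        · intro f
          simp only [RingHom.comp_apply, MvPolynomial.coe_eval₂Hom, MvPolynomial.eval₂_C]
          exact hφ f
        · intro i; simp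
      have h2 : φ.comp (Ideal.Quotient.mk _) q = 0 := by
        rw [RingHom.comp_apply, Ideal.Quotient.eq_zero_iff_mem.2 (Ideal.subset_span hq), map_zero]
      rw [h1] at h2
      exact h2
end Alg



section Wit
set_option linter.unusedSectionVars false
variable {n : ℕ} {κ : Type} [Fintype κ]

lemma closed_exists {X Y : Type*} [TopologicalSpace X] [TopologicalSpace Y] {K : Set Y}
    (hK : IsCompact K) {R : Set (X × Y)} (hR : IsClosed R) :
    IsClosed {x : X | ∃ y ∈ K, (x, y) ∈ R} := by
  have : CompactSpace K := isCompact_iff_compactSpace.mp hK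
  have h1 : IsClosed {p : X × K | (p.1, (p.2 : Y)) ∈ R} :=
    hR.preimage (by fun_prop)
  have h2 := isClosedMap_fst_of_compactSpace (X := X) (Y := K) _ h1
  convert! h2 using 1
  ext x
  simp

lemma proj_entry (A : Matrix (Fin n) (Fin n) ℂ) (hA : A.IsHermitian) (hAA : A * A = A) (i j : Fin n) :
    A i j ∈ Metric.closedBall (0 : ℂ) 1 := by
  have e : ∀ i, (A i i).re = ∑ j, ‖A i j‖ ^ 2 := by
    intro i
    have h := congrFun (congrFun hAA i) i
    rw [Matrix.mul_apply] at h
    rw [← h, Complex.re_sum]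
    refine Finset.sum_congr rfl fun j _ => ?_
    have := hA.apply i j
    rw [← this, Complex.star_def, mul_comm, Complex.mul_conj, Complex.normSq_eq_norm_sq, Complex.ofReal_re]
    rw [Complex.norm_conj] at *
  have e2 : ∀ i j, ‖A i j‖ ^ 2 ≤ (A i i).re := by
    intro i j
    rw [e]
    exact Finset.single_le_sum (f := fun j => ‖A i j‖ ^ 2) (fun _ _ => by positivity) (Finset.mem_univ j)
  have e3 : (A i i).re ≤ 1 := by
    have h3 := e2 i i
    have h4 : |(A i i).re| ≤ ‖A i i‖ := Complex.abs_re_le_norm _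
    have h5 := abs_le.1 h4
    have h6 : 0 ≤ (A i i).re := le_trans (by positivity) h3
    nlinarith
  have e4 := e2 i j
  simp only [Metric.mem_closedBall, dist_zero_right]
  nlinarith [norm_nonneg (A i j)]

/-- compact set of orthogonal projections -/
lemma compact_proj : IsCompact {A : Matrix (Fin n) (Fin n) ℂ | A.IsHermitian ∧ A * A = A} := by
  have h1 : IsCompact (Set.univ.pi fun _ : Fin n => Set.univ.pi fun _ : Fin n =>
      Metric.closedBall (0 : ℂ) 1) :=
    isCompact_univ_pi fun _ => isCompact_univ_pi fun _ => isCompact_closedBall _ _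
  refine h1.of_isClosed_subset ?_ ?_
  · apply IsClosed.inter
    · exact isClosed_eq (by fun_prop) (by fun_prop)
    · exact isClosed_eq (by fun_prop) (by fun_prop)
  · rintro A ⟨hA, hAA⟩ i - j -
    exact proj_entry A hA hAA i j

lemma exists_proj (U : Submodule ℂ (Fin n → ℂ)) : ∃ P : Matrix (Fin n) (Fin n) ℂ,
    P.IsHermitian ∧ P * P = P ∧ P.trace = Module.finrank ℂ U ∧
    (∀ x, P *ᵥ x ∈ U) ∧ ∀ x ∈ U, P *ᵥ x = x := by
  let e := WithLp.linearEquiv 2 ℂ (Fin n → ℂ)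
  let U' : Submodule ℂ (EuclideanSpace ℂ (Fin n)) := U.comap e.toLinearMap
  let L : EuclideanSpace ℂ (Fin n) →ₗ[ℂ] EuclideanSpace ℂ (Fin n) := U'.starProjection
  let P : Matrix (Fin n) (Fin n) ℂ := Matrix.toEuclideanLin.symm L
  have hP : Matrix.toEuclideanLin P = L := LinearEquiv.apply_symm_apply _ _
  have hPx : ∀ x, P *ᵥ x = e (U'.starProjection (e.symm x)) := by
    intro x
    have : Matrix.toEuclideanLin P (e.symm x) = U'.starProjection (e.symm x) := by rw [hP]; rfl
    rw [← this]; rfl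
  have h1 : ∀ x, P *ᵥ x ∈ U := by
    intro x
    rw [hPx]
    exact U'.starProjection_apply_mem (e.symm x)
  have h2 : ∀ x ∈ U, P *ᵥ x = x := by
    intro x hx
    rw [hPx, Submodule.starProjection_eq_self_iff.2]
    · simp
    · simpa [U'] using hx
  refine ⟨P, ?_, ?_, ?_, h1, h2⟩
  · rw [← Matrix.isSymmetric_toEuclideanLin_iff, hP]
    exact U'.starProjection_isSymmetric
  · apply Matrix.toLin'.injective
    ext1 i
    simp only [Matrix.toLin'_mul]
    ext1
    simp only [LinearMap.comp_apply, Matrix.toLin'_apply]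
    rw [h2 _ (h1 _)]
  · have : LinearMap.IsProj U (Matrix.toLin' P) := ⟨fun x => by simpa using h1 x, fun x hx => by
      simpa using h2 x hx⟩
    rw [← this.trace, Matrix.trace_toLin'_eq]

lemma idem_trace (P : Matrix (Fin n) (Fin n) ℂ) (hP : P * P = P) :
    P.trace = Module.finrank ℂ (LinearMap.range (Matrix.toLin' P)) := by
  have : LinearMap.IsProj (LinearMap.range (Matrix.toLin' P)) (Matrix.toLin' P) := ⟨fun x => ⟨x, rfl⟩, by
    rintro _ ⟨x, rfl⟩
    rw [← LinearMap.comp_apply, ← Matrix.toLin'_mul, hP]⟩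
  rw [← this.trace, Matrix.trace_toLin'_eq]

def WitA (h : κ → Matrix (Fin n) (Fin n) ℂ) (r : ℕ) (d : κ → Fin n → ℕ) : Prop :=
  ∃ (P : Matrix (Fin n) (Fin n) ℂ) (Q : κ → Fin n → Matrix (Fin n) (Fin n) ℂ),
    P * P = P ∧ P.trace = r ∧ ∀ k i, Q k i * Q k i = Q k i ∧ (Q k i).trace = d k i ∧
      P * Q k i = Q k i ∧ ∀ j l, i < j → (h k * Q k i) j l = 0

def WitC (h : κ → Matrix (Fin n) (Fin n) ℂ) (r : ℕ) (d : κ → Fin n → ℕ) : Prop :=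
  ∃ (P : Matrix (Fin n) (Fin n) ℂ) (Q : κ → Fin n → Matrix (Fin n) (Fin n) ℂ),
    (P.IsHermitian ∧ P * P = P) ∧ (∀ k i, (Q k i).IsHermitian ∧ Q k i * Q k i = Q k i) ∧
    P.trace = r ∧ ∀ k i, (Q k i).trace = d k i ∧
      P * Q k i = Q k i ∧ ∀ j l, i < j → (h k * Q k i) j l = 0

lemma WitC.toA {h : κ → Matrix (Fin n) (Fin n) ℂ} {r : ℕ} {d : κ → Fin n → ℕ} (H : WitC h r d) :
    WitA h r d := by
  obtain ⟨P, Q, h1, h2, h3, h4⟩ := H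
  exact ⟨P, Q, h1.2, h3, fun k i => ⟨(h2 k i).2, h4 k i⟩⟩

lemma witC_of_sub {h : κ → Matrix (Fin n) (Fin n) ℂ} {r : ℕ} {d : κ → Fin n → ℕ}
    (V : Submodule ℂ (Fin n → ℂ)) (U : κ → Fin n → Submodule ℂ (Fin n → ℂ))
    (hV : Module.finrank ℂ V = r) (hU : ∀ k i, Module.finrank ℂ (U k i) = d k i)
    (hUV : ∀ k i, U k i ≤ V) (hh : ∀ k i, ∀ x ∈ U k i, ∀ j, i < j → (h k *ᵥ x) j = 0) :
    WitC h r d := by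
  obtain ⟨P, p1, p2, p3, p4, p5⟩ := exists_proj V
  choose Q q1 q2 q3 q4 q5 using fun k i => exists_proj (U k i)
  refine ⟨P, Q, ⟨p1, p2⟩, fun k i => ⟨q1 k i, q2 k i⟩, by rw [p3, hV], fun k i => ⟨by rw [q3, hU], ?_, ?_⟩⟩
  · ext a l
    have := congrFun (p5 _ (hUV k i (q4 k i (Pi.single l 1)))) a
    rw [Matrix.mulVec_mulVec] at this
    simpa using this
  · intro j l hj
    have := hh k i _ (q4 k i (Pi.single l 1)) j hj
    rw [Matrix.mulVec_mulVec] at this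
    simpa using this

lemma WitA.toC {h : κ → Matrix (Fin n) (Fin n) ℂ} {r : ℕ} {d : κ → Fin n → ℕ} (H : WitA h r d) :
    WitC h r d := by
  obtain ⟨P, Q, h1, h2, h3⟩ := H
  refine witC_of_sub (LinearMap.range (Matrix.toLin' P)) (fun k i => LinearMap.range (Matrix.toLin' (Q k i)))
    ?_ ?_ ?_ ?_
  · have := idem_trace P h1
    rw [h2] at this
    exact_mod_cast this.symm
  · intro k i
    have := idem_trace (Q k i) (h3 k i).1
    rw [(h3 k i).2.1] at this
    exact_mod_cast this.symm
  · rintro k i _ ⟨x, rfl⟩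
    refine ⟨Q k i *ᵥ x, ?_⟩
    simp [(h3 k i).2.2.1]
  · rintro k i _ ⟨x, rfl⟩ j hj
    simp only [Matrix.toLin'_apply, Matrix.mulVec_mulVec]
    simp only [Matrix.mulVec, dotProduct]
    exact Finset.sum_eq_zero fun l _ => by rw [(h3 k i).2.2.2 j l hj, zero_mul]

lemma witC_le {h : κ → Matrix (Fin n) (Fin n) ℂ} {r : ℕ} {d : κ → Fin n → ℕ} (H : WitC h r d) :
    r ≤ n ∧ ∀ k i, d k i ≤ n := by
  obtain ⟨P, Q, h1, h2, h3, h4⟩ := H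
  have aux : ∀ (P : Matrix (Fin n) (Fin n) ℂ) (m : ℕ), P * P = P → P.trace = m → m ≤ n := by
    intro P m hP hm
    have := idem_trace P hP
    rw [hm] at this
    have h5 : m = Module.finrank ℂ (LinearMap.range (Matrix.toLin' P)) := by exact_mod_cast this
    rw [h5]
    simpa using Submodule.finrank_le (LinearMap.range (Matrix.toLin' P))
  exact ⟨aux P r h1.2 h3, fun k i => aux _ _ (h2 k i).2 (h4 k i).1⟩

lemma witC_closed (h : ℂ → κ → Matrix (Fin n) (Fin n) ℂ) (hc : Continuous h) (r : ℕ)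
    (d : κ → Fin n → ℕ) : IsClosed {t | WitC (h t) r d} := by
  have hK := (compact_proj (n := n)).prod (isCompact_univ_pi fun _ : κ =>
    isCompact_univ_pi fun _ : Fin n => compact_proj (n := n))
  let R : Set (ℂ × (Matrix (Fin n) (Fin n) ℂ × (κ → Fin n → Matrix (Fin n) (Fin n) ℂ))) :=
    {p | p.2.1.trace = r} ∩ ⋂ k, ⋂ i, ({p | (p.2.2 k i).trace = d k i} ∩
      ({p | p.2.1 * p.2.2 k i = p.2.2 k i} ∩ ⋂ j, ⋂ l, {p | i < j → (h p.1 k * p.2.2 k i) j l = 0}))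
  have hR : IsClosed R := by
    refine IsClosed.inter (isClosed_eq (by fun_prop) (by fun_prop)) ?_
    refine isClosed_iInter fun k => isClosed_iInter fun i => ?_
    refine IsClosed.inter (isClosed_eq (by fun_prop) (by fun_prop)) ?_
    refine IsClosed.inter (isClosed_eq (by fun_prop) (by fun_prop)) ?_
    refine isClosed_iInter fun j => isClosed_iInter fun l => ?_
    by_cases hij : i < j
    · simp only [hij, forall_const]
      refine isClosed_eq ?_ (by fun_prop)
      have h1 : Continuous fun p : (ℂ × (Matrix (Fin n) (Fin n) ℂ × (κ → Fin n → Matrix (Fin n) (Fin n) ℂ))) => h p.1 k := by fun_prop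
      have h2 : Continuous fun p : (ℂ × (Matrix (Fin n) (Fin n) ℂ × (κ → Fin n → Matrix (Fin n) (Fin n) ℂ))) => h p.1 k * p.2.2 k i := by fun_prop
      exact h2.matrix_elem j l
    · simp [hij]
  convert! closed_exists hK hR using 1
  ext t
  constructor
  · rintro ⟨P, Q, h1, h2, h3, h4⟩
    refine ⟨(P, Q), ⟨h1, fun k _ i _ => h2 k i⟩, h3, ?_⟩
    simp only [Set.mem_iInter]
    exact fun k i => ⟨(h4 k i).1, (h4 k i).2.1, by simpa using (h4 k i).2.2⟩
  · rintro ⟨⟨P, Q⟩, ⟨h1, h2⟩, h3, h4⟩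
    simp only [Set.mem_iInter] at h4
    exact ⟨P, Q, h1, fun k i => h2 k trivial i trivial, h3, fun k i => ⟨(h4 k i).1, (h4 k i).2.1,
      by simpa using (h4 k i).2.2⟩⟩


lemma wit_dich (h0 h1 : κ → Matrix (Fin n) (Fin n) ℂ) (r : ℕ) (d : κ → Fin n → ℕ) :
    {t : ℂ | WitA (fun k => (1 - t) • h0 k + t • h1 k) r d}.Finite ∨
    {t : ℂ | WitA (fun k => (1 - t) • h0 k + t • h1 k) r d}ᶜ.Finite := by
  let σ := Option (κ × Fin n) × Fin n × Fin n
  let A := MvPolynomial σ (Polynomial ℂ)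
  let P : Matrix (Fin n) (Fin n) A := Matrix.of fun a b => MvPolynomial.X (none, a, b)
  let Q : κ → Fin n → Matrix (Fin n) (Fin n) A :=
    fun k i => Matrix.of fun a b => MvPolynomial.X (some (k, i), a, b)
  let H : κ → Matrix (Fin n) (Fin n) A := fun k => Matrix.of fun a b =>
    MvPolynomial.C ((1 - Polynomial.X) * Polynomial.C (h0 k a b) +
      Polynomial.X * Polynomial.C (h1 k a b))
  let S : Set A := {p | (∃ a b, p = (P * P) a b - P a b) ∨ p = P.trace - (r : A) ∨
    ∃ k i, (∃ a b, p = (Q k i * Q k i) a b - Q k i a b) ∨ p = (Q k i).trace - (d k i : A) ∨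
      (∃ a b, p = (P * Q k i) a b - Q k i a b) ∨ ∃ j l, i < j ∧ p = (H k * Q k i) j l}
  have := alg_dich S
  convert! this using 3
  all_goals
    ext t
    constructor
    · rintro ⟨P', Q', hp, htr, hq⟩
      let x : σ → ℂ := fun s => match s with
        | (none, a, b) => P' a b
        | (some (k, i), a, b) => Q' k i a b
      refine ⟨x, ?_⟩
      have eP : ∀ a b, MvPolynomial.eval₂ (Polynomial.evalRingHom t) x (P a b) = P' a b := by
        intro a b; simp [P, x]
      have eQ : ∀ k i a b, MvPolynomial.eval₂ (Polynomial.evalRingHom t) x (Q k i a b) = Q' k i a b := by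
        intro k i a b; simp [Q, x]
      have eH : ∀ k a b, MvPolynomial.eval₂ (Polynomial.evalRingHom t) x (H k a b) =
          ((1 - t) • h0 k + t • h1 k) a b := by
        intro k a b; simp [H]; ring
      rw [← MvPolynomial.coe_eval₂Hom] at *
      rintro p (⟨a, b, rfl⟩ | rfl | ⟨k, i, ⟨a, b, rfl⟩ | rfl | ⟨a, b, rfl⟩ | ⟨j, l, hij, rfl⟩⟩)
      · simp only [Matrix.mul_apply, map_sub, map_sum, map_mul, eP]
        rw [← Matrix.mul_apply, hp, sub_self]
      · simp only [Matrix.trace, Matrix.diag, map_sub, map_sum, eP, map_natCast]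
        rw [sub_eq_zero]; exact htr
      · simp only [Matrix.mul_apply, map_sub, map_sum, map_mul, eQ]
        rw [← Matrix.mul_apply, (hq k i).1, sub_self]
      · simp only [Matrix.trace, Matrix.diag, map_sub, map_sum, eQ, map_natCast]
        rw [sub_eq_zero]; exact (hq k i).2.1
      · simp only [Matrix.mul_apply, map_sub, map_sum, map_mul, eQ, eP]
        rw [← Matrix.mul_apply, (hq k i).2.2.1, sub_self]
      · simp only [Matrix.mul_apply, map_sum, map_mul, eQ, eH]
        rw [← Matrix.mul_apply, (hq k i).2.2.2 j l hij]
    · rintro ⟨x, hx⟩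
      let P' : Matrix (Fin n) (Fin n) ℂ := Matrix.of fun a b => x (none, a, b)
      let Q' : κ → Fin n → Matrix (Fin n) (Fin n) ℂ :=
        fun k i => Matrix.of fun a b => x (some (k, i), a, b)
      have eP : ∀ a b, MvPolynomial.eval₂ (Polynomial.evalRingHom t) x (P a b) = P' a b := by
        intro a b; simp [P, P']
      have eQ : ∀ k i a b, MvPolynomial.eval₂ (Polynomial.evalRingHom t) x (Q k i a b) = Q' k i a b := by
        intro k i a b; simp [Q, Q']
      have eH : ∀ k a b, MvPolynomial.eval₂ (Polynomial.evalRingHom t) x (H k a b) =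
          ((1 - t) • h0 k + t • h1 k) a b := by
        intro k a b; simp [H]; ring
      rw [← MvPolynomial.coe_eval₂Hom] at *
      refine ⟨P', Q', ?_, ?_, fun k i => ⟨?_, ?_, ?_, ?_⟩⟩
      · ext a b
        have := hx _ (Or.inl ⟨a, b, rfl⟩)
        simp only [Matrix.mul_apply, map_sub, map_sum, map_mul, eP] at this
        rw [← Matrix.mul_apply] at this
        exact sub_eq_zero.1 this
      · have := hx _ (Or.inr (Or.inl rfl))
        simp only [Matrix.trace, Matrix.diag, map_sub, map_sum, eP, map_natCast] at this
        exact sub_eq_zero.1 this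
      · ext a b
        have := hx _ (Or.inr (Or.inr ⟨k, i, Or.inl ⟨a, b, rfl⟩⟩))
        simp only [Matrix.mul_apply, map_sub, map_sum, map_mul, eQ] at this
        rw [← Matrix.mul_apply] at this
        exact sub_eq_zero.1 this
      · have := hx _ (Or.inr (Or.inr ⟨k, i, Or.inr (Or.inl rfl)⟩))
        simp only [Matrix.trace, Matrix.diag, map_sub, map_sum, eQ, map_natCast] at this
        exact sub_eq_zero.1 this
      · ext a b
        have := hx _ (Or.inr (Or.inr ⟨k, i, Or.inr (Or.inr (Or.inl ⟨a, b, rfl⟩))⟩))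
        simp only [Matrix.mul_apply, map_sub, map_sum, map_mul, eQ, eP] at this
        rw [← Matrix.mul_apply] at this
        exact sub_eq_zero.1 this
      · intro j l hij
        have := hx _ (Or.inr (Or.inr ⟨k, i, Or.inr (Or.inr (Or.inr ⟨j, l, hij, rfl⟩))⟩))
        simp only [Matrix.mul_apply, map_sum, map_mul, eQ, eH] at this
        rw [← Matrix.mul_apply] at this
        exact this

lemma wit_all (h0 h1 : κ → Matrix (Fin n) (Fin n) ℂ) (r : ℕ) (d : κ → Fin n → ℕ)
    (hinf : {t : ℂ | WitC (fun k => (1 - t) • h0 k + t • h1 k) r d}.Infinite) (t : ℂ) :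
    WitC (fun k => (1 - t) • h0 k + t • h1 k) r d := by
  have hcl := witC_closed (fun t k => (1 - t) • h0 k + t • h1 k) (by fun_prop) r d
  have e : {t : ℂ | WitC (fun k => (1 - t) • h0 k + t • h1 k) r d} =
      {t : ℂ | WitA (fun k => (1 - t) • h0 k + t • h1 k) r d} := by
    ext t; exact ⟨WitC.toA, WitA.toC⟩
  have hcof := (wit_dich h0 h1 r d).resolve_left (by rw [← e]; exact hinf)
  rw [← e] at hcof
  have hd : Dense {t : ℂ | WitC (fun k => (1 - t) • h0 k + t • h1 k) r d} := by
    rw [← compl_compl {t : ℂ | WitC (fun k => (1 - t) • h0 k + t • h1 k) r d}]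
    exact hcof.countable.dense_compl ℂ
  have := hcl.closure_eq ▸ hd.closure_eq
  exact (Set.eq_univ_iff_forall.1 this) t

lemma generic_exists (h0 h1 : κ → Matrix (Fin n) (Fin n) ℂ) (hdet : ∀ k, (h0 k).det ≠ 0) :
    ∃ h : κ → Matrix (Fin n) (Fin n) ℂ, (∀ k, (h k).det ≠ 0) ∧
      ∀ r d, WitC h r d → WitC h0 r d ∧ WitC h1 r d := by
  let hh : ℂ → κ → Matrix (Fin n) (Fin n) ℂ := fun t k => (1 - t) • h0 k + t • h1 k
  let E1 : Set ℂ := ⋃ k, {t | (hh t k).det = 0}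
  let E2 : Set ℂ := ⋃ D : Fin (n + 1) × (κ → Fin n → Fin (n + 1)),
    {t | WitC (hh t) D.1 (fun k i => D.2 k i) ∧ ¬ ∀ t, WitC (hh t) D.1 (fun k i => D.2 k i)}
  have hE1 : E1.Finite := by
    refine Set.finite_iUnion fun k => ?_
    let p : Polynomial ℂ := Matrix.det (Matrix.of fun a b => ((1 - Polynomial.X) * Polynomial.C (h0 k a b) +
      Polynomial.X * Polynomial.C (h1 k a b)))
    have hp : ∀ t, p.eval t = (hh t k).det := by
      intro t
      rw [← Polynomial.coe_evalRingHom, RingHom.map_det]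
      congr 1
      ext a b
      simp [hh]; ring
    have hp0 : p ≠ 0 := by
      intro h
      apply hdet k
      have := hp 0
      rw [h] at this
      simpa [hh] using this.symm
    refine (Polynomial.finite_setOfPred_isRoot hp0).subset ?_
    intro t ht
    change p.eval t = 0
    rw [hp]; exact ht
  have hE2 : E2.Finite := by
    refine Set.finite_iUnion fun D => ?_
    by_contra hinf
    have h2 : {t | WitC (hh t) D.1 (fun k i => (D.2 k i : ℕ))}.Infinite :=
      Set.Infinite.mono (fun t ht => ht.1) hinf
    have h3 := wit_all h0 h1 _ _ h2
    obtain ⟨t, ht⟩ := Set.Infinite.nonempty hinf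
    exact ht.2 h3
  obtain ⟨t, ht⟩ := (hE1.union hE2).infinite_compl.nonempty
  simp only [Set.mem_compl_iff, Set.mem_union, not_or] at ht
  refine ⟨hh t, fun k hk => ht.1 (Set.mem_iUnion.2 ⟨k, hk⟩), fun r d hw => ?_⟩
  obtain ⟨hr, hd⟩ := witC_le hw
  have hall : ∀ t, WitC (hh t) r d := by
    by_contra hne
    apply ht.2
    refine Set.mem_iUnion.2 ⟨(⟨r, by omega⟩, fun k i => ⟨d k i, Nat.lt_succ_of_le (hd k i)⟩), hw, hne⟩
  refine ⟨?_, ?_⟩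
  · simpa [hh] using hall 0
  · simpa [hh] using hall 1

end Wit



section LinAlg
open scoped ComplexOrder
variable {n : ℕ}

lemma pivot_aux {E : Type*} [AddCommGroup E] [Module ℂ E] [FiniteDimensional ℂ E] (N : Fin n → E) :
    ∃ I : Finset (Fin n), ∀ j : ℕ, j ≤ n →
      Submodule.span ℂ (N '' {a | a ∈ I ∧ a.val < j}) = Submodule.span ℂ (N '' {a | a.val < j}) ∧
      (I.filter (fun a => a.val < j)).card =
        Module.finrank ℂ (Submodule.span ℂ (N '' {a | a.val < j})) := by
  classical
  let I : Finset (Fin n) := Finset.univ.filter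
    (fun a => N a ∉ Submodule.span ℂ (N '' {b | b.val < a.val}))
  refine ⟨I, fun j => ?_⟩
  induction j with
  | zero =>
    intro _
    have h0 : {a : Fin n | a.val < 0} = ∅ := by ext; simp
    rw [h0, Set.image_empty, Submodule.span_empty, finrank_bot]
    simp
  | succ j ih =>
    intro hj
    obtain ⟨ih1, ih2⟩ := ih (by omega)
    let a : Fin n := ⟨j, by omega⟩
    have e1 : {b : Fin n | b.val < j + 1} = insert a {b | b.val < j} := by
      ext b; simp [a, Fin.ext_iff]; omega
    by_cases ha : N a ∈ Submodule.span ℂ (N '' {b | b.val < j})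
    · have haI : a ∉ I := by
        simp only [I, Finset.mem_filter, Finset.mem_univ, true_and, not_not]; exact ha
      have e2 : {b : Fin n | b ∈ I ∧ b.val < j + 1} = {b | b ∈ I ∧ b.val < j} := by
        ext b
        simp only [Set.mem_ofPred_eq, and_congr_right_iff]
        intro hb
        have : b ≠ a := fun h => haI (h ▸ hb)
        have : b.val ≠ j := fun h => this (Fin.ext h)
        omega
      have e3 : I.filter (fun b => b.val < j + 1) = I.filter (fun b => b.val < j) := by
        ext b
        have := Set.ext_iff.1 e2 b
        simpa using this
      have e4 : Submodule.span ℂ (N '' {b : Fin n | b.val < j + 1}) =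
          Submodule.span ℂ (N '' {b : Fin n | b.val < j}) := by
        rw [e1, Set.image_insert_eq, Submodule.span_insert, sup_eq_right, Submodule.span_singleton_le_iff_mem]
        exact ha
      rw [e2, e3, e4]
      exact ⟨ih1, ih2⟩
    · have haI : a ∈ I := by
        simp only [I, Finset.mem_filter, Finset.mem_univ, true_and]; exact ha
      have e2 : {b : Fin n | b ∈ I ∧ b.val < j + 1} = insert a {b | b ∈ I ∧ b.val < j} := by
        ext b
        simp only [Set.mem_ofPred_eq, Set.mem_insert_iff]
        constructor
        · rintro ⟨h1, h2⟩
          by_cases h : b.val = j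
          · left; exact Fin.ext h
          · right; exact ⟨h1, by omega⟩
        · rintro (rfl | ⟨h1, h2⟩)
          · exact ⟨haI, by simp [a]⟩
          · exact ⟨h1, by omega⟩
      have e3 : I.filter (fun b => b.val < j + 1) = insert a (I.filter (fun b => b.val < j)) := by
        ext b
        have := Set.ext_iff.1 e2 b
        simpa using this
      have hna : a ∉ I.filter (fun b => b.val < j) := by simp [a]
      have hv : N a ≠ 0 := fun h => ha (by rw [h]; exact Submodule.zero_mem _)
      rw [e2, e3, e1, Set.image_insert_eq, Set.image_insert_eq, Submodule.span_insert,
        Submodule.span_insert, ih1, Finset.card_insert_of_notMem hna, ih2]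
      refine ⟨rfl, ?_⟩
      have := Submodule.finrank_sup_add_finrank_inf_eq (Submodule.span ℂ {N a})
        (Submodule.span ℂ (N '' {b | b.val < j}))
      rw [finrank_span_singleton hv, (Submodule.disjoint_span_singleton' hv).2 ha |>.symm.eq_bot] at this
      rw [finrank_bot] at this
      omega

lemma pivots {m : Type} [Fintype m] [DecidableEq m] (N : Matrix (Fin n) m ℂ)
    (hN : Function.Injective N.mulVec) :
    ∃ e : m → Fin n, Function.Injective e ∧ (N.submatrix e id).det ≠ 0 ∧
      ∀ j : ℕ, j ≤ n → (Finset.univ.filter (fun x => j ≤ (e x).val)).card =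
        Module.finrank ℂ (LinearMap.ker (N.submatrix (fun a : {a : Fin n // a.val < j} => a.1) id).mulVecLin) := by
  classical
  obtain ⟨I, hI⟩ := pivot_aux (E := m → ℂ) N
  have hrk : ∀ j : ℕ, (N.submatrix (fun a : {a : Fin n // a.val < j} => a.1) id).rank =
      Module.finrank ℂ (Submodule.span ℂ (N '' {a | a.val < j})) := by
    intro j
    rw [Matrix.rank_eq_finrank_span_row]
    have hset : Set.range (N.submatrix (fun a : {a : Fin n // a.val < j} => a.1) id).row =
        N '' {a | a.val < j} := by
     ext v
     constructor
     · rintro ⟨a, rfl⟩; exact ⟨a.1, a.2, rfl⟩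
     · rintro ⟨a, ha, rfl⟩; exact ⟨⟨a, ha⟩, rfl⟩
    rw [hset]
  have hker : ∀ j : ℕ, Module.finrank ℂ (Submodule.span ℂ (N '' {a | a.val < j})) +
      Module.finrank ℂ (LinearMap.ker (N.submatrix (fun a : {a : Fin n // a.val < j} => a.1) id).mulVecLin) =
      Fintype.card m := by
    intro j
    rw [← hrk, Matrix.rank, LinearMap.finrank_range_add_finrank_ker]
    simp
  have hkn : Module.finrank ℂ (LinearMap.ker (N.submatrix (fun a : {a : Fin n // a.val < n} => a.1) id).mulVecLin) = 0 := by
    rw [Submodule.finrank_eq_zero, LinearMap.ker_eq_bot]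
    intro x y hxy
    apply hN
    ext a
    exact congrFun hxy ⟨a, a.2⟩
  have hIc : I.card = Fintype.card m := by
    have h1 := (hI n le_rfl).2
    have h2 := hker n
    have h3 : I.filter (fun a => a.val < n) = I := by
      apply Finset.filter_true_of_mem; intro a _; exact a.2
    rw [h3] at h1
    omega
  let f : m ≃ I := Fintype.equivOfCardEq (by simp [hIc])
  refine ⟨fun x => (f x).1, fun x y h => f.injective (Subtype.ext h), ?_, ?_⟩
  · have hu : IsUnit (N.submatrix (fun x => (f x).1) id) := by
      rw [← Matrix.linearIndependent_rows_iff_isUnit, linearIndependent_iff_card_eq_finrank_span]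
      have h1 := (hI n le_rfl).1
      have h2 := hker n
      rw [← h1] at h2
      rw [← h2, hkn, add_zero, Set.finrank]
      have hset : Set.range (N.submatrix (fun x => (f x).1) id).row =
          N '' {a | a ∈ I ∧ a.val < n} := by
        ext v
        constructor
        · rintro ⟨x, rfl⟩; exact ⟨(f x).1, ⟨(f x).2, (f x).1.2⟩, rfl⟩
        · rintro ⟨a, ha, rfl⟩
          obtain ⟨x, hx⟩ := f.surjective ⟨a, ha.1⟩
          exact ⟨x, by ext y; simp [Matrix.row, hx]⟩
      rw [hset]
    exact ((Matrix.isUnit_iff_isUnit_det _).1 hu).ne_zero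
  · intro j hj
    have h1 := (hI j hj).2
    have h2 := hker j
    have h3 : (Finset.univ.filter (fun x => j ≤ (f x).1.val)).card =
        (I.filter (fun a => ¬ a.val < j)).card := by
      apply Finset.card_bij (fun x _ => (f x).1)
      · intro x hx; simp at hx ⊢; exact hx
      · intro x _ y _ h; exact f.injective (Subtype.ext h)
      · intro a ha
        simp at ha
        obtain ⟨x, hx⟩ := f.surjective ⟨a, ha.1⟩
        exact ⟨x, by simp [hx, ha.2], by rw [hx]⟩
    have h4 := Finset.card_filter_add_card_filter_not (s := I) (fun a => a.val < j)
    beta_reduce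
    omega

lemma det_one_add_psd {m : Type} [Fintype m] [DecidableEq m] (C : Matrix m m ℂ) (hC : C.PosSemidef) :
    1 ≤ (1 + C).det.re := by
  have h1 := hC.1.spectral_theorem
  rw [Unitary.conjStarAlgAut_apply] at h1
  set u := (hC.1.eigenvectorUnitary : Matrix m m ℂ)
  have hu : u * star u = 1 := Unitary.mul_star_self_of_mem hC.1.eigenvectorUnitary.2
  have h2 : 1 + C = u * (1 + diagonal (RCLike.ofReal ∘ hC.1.eigenvalues)) * star u := by
    rw [mul_add, add_mul, mul_one, hu, ← h1]
  have h3 : u.det * (star u).det = 1 := by rw [← Matrix.det_mul, hu, Matrix.det_one]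
  rw [h2, Matrix.det_mul, Matrix.det_mul, mul_right_comm, h3, one_mul, ← Matrix.diagonal_one,
    Matrix.diagonal_add, Matrix.det_diagonal]
  have : (∏ i, (1 + (RCLike.ofReal ∘ hC.1.eigenvalues) i) : ℂ) = ((∏ i, (1 + hC.1.eigenvalues i) : ℝ) : ℂ) := by
    push_cast; rfl
  rw [this, Complex.ofReal_re]
  exact Finset.prod_induction _ (fun x => (1 : ℝ) ≤ x) (fun a b => one_le_mul_of_one_le_of_one_le) le_rfl
    (fun i _ => by have := hC.eigenvalues_nonneg i; linarith)

lemma det_mono_psd {m : Type} [Fintype m] [DecidableEq m] (Y C : Matrix m m ℂ) (hC : C.PosSemidef)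
    (hY : Y.det ≠ 0) : ‖Y.det‖ ^ 2 ≤ (Yᴴ * Y + C).det.re := by
  have hu : IsUnit Y.det := isUnit_iff_ne_zero.2 hY
  have h1 : Yᴴ * Y + C = Yᴴ * (1 + (Y⁻¹)ᴴ * C * Y⁻¹) * Y := by
    rw [mul_add, add_mul, mul_one]
    congr 1
    rw [← mul_assoc, ← mul_assoc, ← Matrix.conjTranspose_mul, Matrix.nonsing_inv_mul _ hu,
      Matrix.conjTranspose_one, one_mul, mul_assoc, Matrix.nonsing_inv_mul _ hu, mul_one]
  have h2 := det_one_add_psd _ (hC.conjTranspose_mul_mul_same Y⁻¹)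
  rw [h1, Matrix.det_mul, Matrix.det_mul, mul_right_comm, Matrix.det_conjTranspose, mul_comm (star _),
    Complex.star_def, Complex.mul_conj, Complex.re_ofReal_mul, Complex.normSq_eq_norm_sq]
  nlinarith [sq_nonneg ‖Y.det‖]

lemma det_ge_minor {m : Type} [Fintype m] [DecidableEq m] (N : Matrix (Fin n) m ℂ) (D : Fin n → ℝ)
    (hD : ∀ a, 0 < D a) (e : m → Fin n) (he : Function.Injective e) (hdet : (N.submatrix e id).det ≠ 0) :
    ‖(N.submatrix e id).det‖ ^ 2 * ∏ x, D (e x) ≤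
      (Nᴴ * diagonal (fun a => (D a : ℂ)) * N).det.re := by
  classical
  let Y : Matrix m m ℂ := diagonal (fun x => ((Real.sqrt (D (e x)) : ℝ) : ℂ)) * N.submatrix e id
  let C : Matrix m m ℂ := Nᴴ * diagonal (fun a => ((if a ∈ Set.range e then 0 else D a : ℝ) : ℂ)) * N
  have hC : C.PosSemidef := by
    apply PosSemidef.conjTranspose_mul_mul_same
    apply PosSemidef.diagonal
    intro a
    simp only [Pi.zero_apply]
    split_ifs
    · simp
    · exact_mod_cast (hD a).le
  have hYd : Y.det = ((∏ x, Real.sqrt (D (e x)) : ℝ) : ℂ) * (N.submatrix e id).det := by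
    rw [Matrix.det_mul, Matrix.det_diagonal]; push_cast; rfl
  have hpos : 0 < ∏ x, Real.sqrt (D (e x)) := Finset.prod_pos fun x _ => Real.sqrt_pos.2 (hD _)
  have hY : Y.det ≠ 0 := by
    rw [hYd]
    exact mul_ne_zero (by exact_mod_cast hpos.ne') hdet
  have h := det_mono_psd Y C hC hY
  have h1 : Yᴴ * Y + C = Nᴴ * diagonal (fun a => (D a : ℂ)) * N := by
    ext x y
    simp only [Y, C, Matrix.conjTranspose_mul, Matrix.diagonal_conjTranspose, Matrix.add_apply]
    rw [Matrix.mul_assoc, Matrix.mul_apply]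
    simp only [Matrix.mul_apply, Matrix.diagonal_apply, Matrix.conjTranspose_apply, Matrix.submatrix_apply,
      ite_mul, mul_ite, zero_mul, mul_zero, Finset.sum_ite_eq, Finset.sum_ite_eq', Finset.mem_univ, if_true, id]
    have hs : ∀ f : Fin n → ℂ, ∑ x, f (e x) = ∑ a, if a ∈ Set.range e then f a else 0 := by
      intro f
      rw [← Finset.sum_filter, ← Finset.sum_image (f := f) (g := e) (s := Finset.univ) (fun a _ b _ h => he h)]
      congr 1
      ext a; simp
    have h2 : ∀ z, star (N (e z) x) * (star (fun x => ((Real.sqrt (D (e x)) : ℝ) : ℂ)) z *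
        (((Real.sqrt (D (e z)) : ℝ) : ℂ) * N (e z) y)) = (fun a => star (N a x) * (D a : ℂ) * N a y) (e z) := by
      intro z
      have : ((Real.sqrt (D (e z)) : ℝ) : ℂ) * ((Real.sqrt (D (e z)) : ℝ) : ℂ) = D (e z) := by
        rw [← Complex.ofReal_mul, Real.mul_self_sqrt (hD _).le]
      simp only [Pi.star_apply, Complex.star_def, Complex.conj_ofReal]
      rw [← this]; ring
    rw [Finset.sum_congr rfl (fun z _ => h2 z), hs (fun a => star (N a x) * (D a : ℂ) * N a y), ← Finset.sum_add_distrib]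
    refine Finset.sum_congr rfl fun a _ => ?_
    split_ifs <;> simp
  rw [h1, hYd, norm_mul, mul_pow, Complex.norm_real, Real.norm_of_nonneg hpos.le, ← Finset.prod_pow] at h
  simp only [Real.sq_sqrt (hD _).le] at h
  linarith

lemma qr_exists (A : Matrix (Fin n) (Fin n) ℂ) (hA : A.det ≠ 0) :
    ∃ T : Matrix (Fin n) (Fin n) ℂ, (∀ a b, b < a → T a b = 0) ∧ (A * T)ᴴ * (A * T) = 1 := by
  have hu : IsUnit A := (Matrix.isUnit_iff_isUnit_det _).2 (isUnit_iff_ne_zero.2 hA)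
  have hS : (Aᴴ * A).PosDef := PosDef.conjTranspose_mul_self A (Matrix.mulVec_injective_of_isUnit hu)
  let P := LDL.lowerInv hS
  have hP : LDL.diag hS = P * (Aᴴ * A) * Pᴴ := LDL.diag_eq_lowerInv_conj hS
  have hPu : IsUnit Pᴴ := by
    have : Invertible P := LDL.invertibleLowerInv hS
    exact (isUnit_of_invertible P).star
  have hpd : (LDL.diag hS).PosDef := by
    have := hS.conjTranspose_mul_mul_same (B := Pᴴ) (Matrix.mulVec_injective_of_isUnit hPu)
    rw [Matrix.conjTranspose_conjTranspose] at this
    rw [hP]; exact this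
  have hpos : ∀ a, 0 < LDL.diagEntries hS a := by
    intro a
    have := hpd.diag_pos (i := a)
    simpa [LDL.diag] using this
  have hre : ∀ a, LDL.diagEntries hS a = (((LDL.diagEntries hS a).re : ℝ) : ℂ) ∧ 0 < (LDL.diagEntries hS a).re := by
    intro a
    obtain ⟨h1, h2⟩ := Complex.lt_def.1 (hpos a)
    exact ⟨Complex.ext (by simp) (by simpa using h2.symm), by simpa using h1⟩
  let s : Fin n → ℂ := fun a => (((Real.sqrt (LDL.diagEntries hS a).re)⁻¹ : ℝ) : ℂ)
  refine ⟨Pᴴ * diagonal s, ?_, ?_⟩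
  · intro a b hab
    rw [Matrix.mul_diagonal, Matrix.conjTranspose_apply]
    have : P b a = 0 := LDL.lowerInv_triangular hS hab
    rw [this]; simp
  · have : (A * (Pᴴ * diagonal s))ᴴ * (A * (Pᴴ * diagonal s)) = (diagonal s)ᴴ * LDL.diag hS * diagonal s := by
      rw [hP]
      simp only [Matrix.conjTranspose_mul, Matrix.conjTranspose_conjTranspose, Matrix.mul_assoc]
    rw [this, LDL.diag, Matrix.diagonal_conjTranspose, Matrix.diagonal_mul_diagonal, Matrix.diagonal_mul_diagonal,
      ← Matrix.diagonal_one]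
    congr 1
    ext1 a
    obtain ⟨h1, h2⟩ := hre a
    rw [h1]
    simp only [s, Pi.star_apply, Complex.star_def, Complex.conj_ofReal]
    rw [← Complex.ofReal_mul, ← Complex.ofReal_mul, ← Complex.ofReal_one, Complex.ofReal_inj]
    have h3 := Real.mul_self_sqrt h2.le
    have h4 := Real.sqrt_pos.2 h2
    field_simp
    nlinarith

lemma spectral_sorted (A : Matrix (Fin n) (Fin n) ℂ) (hA : A.IsHermitian) :
    ∃ u : Matrix (Fin n) (Fin n) ℂ, uᴴ * u = 1 ∧ Antitone (eigsDesc hA) ∧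
      A = u * diagonal (fun a => (eigsDesc hA a : ℂ)) * uᴴ := by
  have h1 := hA.spectral_theorem
  rw [Unitary.conjStarAlgAut_apply] at h1
  set u := (hA.eigenvectorUnitary : Matrix (Fin n) (Fin n) ℂ)
  have hu : star u * u = 1 := Unitary.star_mul_self_of_mem hA.eigenvectorUnitary.2
  let π : Fin n ≃ Fin n := Fin.revPerm.trans (Tuple.sort hA.eigenvalues)
  have hπ : ∀ a, eigsDesc hA a = hA.eigenvalues (π a) := fun a => rfl
  refine ⟨u.submatrix id π, ?_, ?_, ?_⟩
  · rw [Matrix.conjTranspose_submatrix, ← Matrix.submatrix_mul _ _ _ id _ Function.bijective_id]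
    rw [← Matrix.star_eq_conjTranspose, hu]
    exact Matrix.submatrix_one_equiv π
  · intro a b hab
    have := Tuple.monotone_sort hA.eigenvalues (Fin.rev_le_rev.2 hab)
    exact this
  · conv_lhs => rw [h1]
    ext a b
    rw [Matrix.mul_apply, Matrix.mul_apply]
    simp only [Matrix.mul_diagonal, Matrix.conjTranspose_apply, Matrix.submatrix_apply, id, Matrix.star_apply]
    rw [← Equiv.sum_comp π]
    rfl

lemma eigs_unique (A : Matrix (Fin n) (Fin n) ℂ) (hA : A.IsHermitian) (u : Matrix (Fin n) (Fin n) ℂ)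
    (hu : uᴴ * u = 1) (l : Fin n → ℝ) (hl : Antitone l)
    (h : A = u * diagonal (fun a => (l a : ℂ)) * uᴴ) : eigsDesc hA = l := by
  obtain ⟨v, hv, ha, hv2⟩ := spectral_sorted A hA
  have aux : ∀ (u : Matrix (Fin n) (Fin n) ℂ) (l : Fin n → ℝ), uᴴ * u = 1 →
      A = u * diagonal (fun a => (l a : ℂ)) * uᴴ →
      A.charpoly.roots = (Finset.univ.val.map l).map (fun x : ℝ => (x : ℂ)) := by
    intro u l hu h
    rw [h, Matrix.mul_assoc, Matrix.charpoly_mul_comm, Matrix.mul_assoc, hu, Matrix.mul_one, Matrix.charpoly_diagonal]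
    have := Polynomial.roots_multiset_prod_X_sub_C (Finset.univ.val.map (fun a => (l a : ℂ)))
    rw [Multiset.map_map] at this ⊢
    exact this
  have h1 := (aux v _ hv hv2).symm.trans (aux u l hu h)
  have h2 := Multiset.map_injective Complex.ofReal_injective h1
  have h3 : (List.ofFn (eigsDesc hA)).Perm (List.ofFn l) := by
    rw [← Multiset.coe_eq_coe]
    simpa [Fin.univ_val_map] using h2
  have h4 : List.ofFn (eigsDesc hA) = List.ofFn l := by
    refine h3.eq_of_pairwise (le := (· ≥ ·)) (fun a b _ _ h1 h2 => le_antisymm h2 h1) ?_ ?_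
    · rw [List.pairwise_ofFn]; intro i j hij; exact ha hij.le
    · rw [List.pairwise_ofFn]; intro i j hij; exact hl hij.le
  exact List.ofFn_injective h4

end LinAlg



section PartA
open scoped ComplexOrder
variable {n : ℕ} {κ : Type} [Fintype κ]

/-- The spectrum with given successive gaps. -/
noncomputable def lamOf (γ : Fin n → ℝ) (j : Fin n) : ℝ := ∑ i, if j ≤ i then γ i else 0

/-- The semistability inequalities for the filtrations attached to `h`. -/
def Sst (γ : κ → Fin n → ℝ) (h : κ → Matrix (Fin n) (Fin n) ℂ) : Prop :=
  ∀ (r : ℕ) (d : κ → Fin n → ℕ), (∀ k i, i.val + 1 = n → d k i = r) → WitC h r d →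
    ∑ k, ∑ i, γ k i * d k i ≤ 0

lemma trace_proj_nonneg (P G : Matrix (Fin n) (Fin n) ℂ) (hP : P.IsHermitian) (hP2 : P * P = P)
    (hG : G.IsHermitian) (hG2 : G * G = G) : 0 ≤ (P * G).trace.re := by
  have h1 : (P * G).trace = ((G * P)ᴴ * (G * P)).trace := by
    rw [conjTranspose_mul, hP.eq, hG.eq, Matrix.mul_assoc, ← Matrix.mul_assoc G G P, hG2, Matrix.trace_mul_comm,
      ← Matrix.trace_mul_comm (G * P) P, Matrix.mul_assoc, hP2]
  rw [h1]
  have h2 := (Matrix.posSemidef_conjTranspose_mul_self (G * P)).trace_nonneg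
  exact (Complex.le_def.1 h2).1

lemma partA (γ : κ → Fin n → ℝ) (hγ : ∀ k i, i.val + 1 < n → 0 ≤ γ k i)
    (u : κ → Matrix (Fin n) (Fin n) ℂ) (hu : ∀ k, (u k)ᴴ * u k = 1)
    (hs : ∑ k, u k * diagonal (fun a => (lamOf (γ k) a : ℂ)) * (u k)ᴴ = 0) :
    Sst γ (fun k => (u k)ᴴ) := by
  rintro r d hd ⟨P, Q, hP, hQ, htr, h⟩
  have hu' : ∀ k, u k * (u k)ᴴ = 1 := fun k => mul_eq_one_comm.1 (hu k)
  let E : Fin n → Matrix (Fin n) (Fin n) ℂ := fun i => diagonal (fun j => if j ≤ i then 1 else 0)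
  have hE : ∀ i, E i * E i = E i := fun i => by
    simp only [E, diagonal_mul_diagonal]; congr 1; ext j; split_ifs <;> simp
  have hEh : ∀ i, (E i)ᴴ = E i := fun i => by
    simp only [E, diagonal_conjTranspose]; congr 1; ext j; simp only [Pi.star_apply]; split_ifs <;> simp
  let F : κ → Fin n → Matrix (Fin n) (Fin n) ℂ := fun k i => u k * E i * (u k)ᴴ
  have hFh : ∀ k i, (F k i).IsHermitian := fun k i => by
    simp only [F, IsHermitian, conjTranspose_mul, conjTranspose_conjTranspose, hEh, Matrix.mul_assoc]
  have hF2 : ∀ k i, F k i * F k i = F k i := fun k i => by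
    calc F k i * F k i = u k * E i * ((u k)ᴴ * u k) * E i * (u k)ᴴ := by simp only [F, Matrix.mul_assoc]
      _ = u k * (E i * E i) * (u k)ᴴ := by rw [hu]; simp only [Matrix.mul_assoc, Matrix.one_mul]
      _ = _ := by rw [hE]
  have hFQ : ∀ k i, F k i * Q k i = Q k i := fun k i => by
    have h1 : E i * ((u k)ᴴ * Q k i) = (u k)ᴴ * Q k i := by
      ext j l
      rw [diagonal_mul]
      split_ifs with hij
      · simp
      · rw [(h k i).2.2 j l (not_le.1 hij)]; simp
    simp only [F, Matrix.mul_assoc]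
    rw [h1, ← Matrix.mul_assoc, hu', Matrix.one_mul]
  have hQF : ∀ k i, Q k i * F k i = Q k i := fun k i => by
    have := congrArg conjTranspose (hFQ k i)
    rwa [conjTranspose_mul, (hFh k i).eq, (hQ k i).1.eq] at this
  have hle : ∀ k i, γ k i * d k i ≤ γ k i * (P * F k i).trace.re := by
    intro k i
    by_cases hi : i.val + 1 = n
    · have hE1 : E i = 1 := by
        rw [← diagonal_one]; simp only [E]; congr 1; ext j; rw [if_pos]; rw [Fin.le_def]; omega
      have : F k i = 1 := by simp only [F]; rw [hE1, Matrix.mul_one, hu']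
      rw [this, Matrix.mul_one, htr, hd k i hi]
      simp
    · refine mul_le_mul_of_nonneg_left ?_ (hγ k i (by omega))
      have := trace_proj_nonneg P (F k i - Q k i) hP.1 hP.2 ((hFh k i).sub (hQ k i).1) (by
        rw [Matrix.sub_mul, Matrix.mul_sub, Matrix.mul_sub, hF2, hFQ, hQF, (hQ k i).2]; simp)
      rw [Matrix.mul_sub, (h k i).2.1, Matrix.trace_sub, (h k i).1] at this
      simpa using this
  have hdiag : ∀ k, diagonal (fun a => (lamOf (γ k) a : ℂ)) = ∑ i, (γ k i : ℂ) • E i := by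
    intro k
    ext a b
    rw [Matrix.sum_apply, diagonal_apply]
    split_ifs with hab
    · subst hab
      simp only [lamOf, E, Matrix.smul_apply, diagonal_apply_eq, Complex.ofReal_sum, smul_eq_mul]
      exact Finset.sum_congr rfl fun i _ => by split_ifs <;> simp
    · simp [E, hab]
  have hK : ∀ k, (P * (u k * diagonal (fun a => (lamOf (γ k) a : ℂ)) * (u k)ᴴ)).trace.re =
      ∑ i, γ k i * (P * F k i).trace.re := by
    intro k
    rw [hdiag, Matrix.mul_sum, Matrix.sum_mul, Matrix.mul_sum, Matrix.trace_sum, Complex.re_sum]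
    refine Finset.sum_congr rfl fun i _ => ?_
    rw [Matrix.mul_smul, Matrix.smul_mul, Matrix.mul_smul, Matrix.trace_smul, smul_eq_mul, Complex.re_ofReal_mul]
  calc ∑ k, ∑ i, γ k i * d k i ≤ ∑ k, ∑ i, γ k i * (P * F k i).trace.re :=
        Finset.sum_le_sum fun k _ => Finset.sum_le_sum fun i _ => hle k i
    _ = (P * ∑ k, u k * diagonal (fun a => (lamOf (γ k) a : ℂ)) * (u k)ᴴ).trace.re := by
        rw [Matrix.mul_sum, Matrix.trace_sum, Complex.re_sum]
        exact Finset.sum_congr rfl fun k _ => (hK k).symm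
    _ = 0 := by rw [hs]; simp

end PartA



section PartC1
open scoped ComplexOrder
variable {n : ℕ} {κ : Type} [Fintype κ]

/-- leading block -/
def blk (M : Matrix (Fin n) (Fin n) ℂ) (i : Fin n) : Matrix {j : Fin n // j ≤ i} {j : Fin n // j ≤ i} ℂ :=
  M.submatrix Subtype.val Subtype.val

/-- first columns -/
def colz (M : Matrix (Fin n) (Fin n) ℂ) (i : Fin n) : Matrix (Fin n) {j : Fin n // j ≤ i} ℂ :=
  M.submatrix id Subtype.val

/-- The Kempf-Ness type function. -/
noncomputable def fH (γ : κ → Fin n → ℝ) (g : κ → Matrix (Fin n) (Fin n) ℂ)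
    (H : Matrix (Fin n) (Fin n) ℂ) : ℝ :=
  ∑ k, ∑ i, γ k i * Real.log (blk ((g k)ᴴ * H * g k) i).det.re

lemma abel_aux : ∀ (n : ℕ) (c L : Fin n → ℝ) (B : ℝ), Antitone L → (∀ a, L a ≤ B) →
    (∀ m : ℕ, ∑ a, (if m ≤ a.val then c a else 0) ≤ 0) → (∑ a, c a) * B ≤ ∑ a, c a * L a := by
  intro n
  induction n with
  | zero => intros; simp
  | succ n ih =>
    intro c L B hL hB ht
    have h0 := ht 0
    simp only [Nat.zero_le, if_true] at h0
    have h1 := ih (fun a => c a.succ) (fun a => L a.succ) (L 0) (fun a b hab => hL (Fin.succ_le_succ_iff.2 hab))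
      (fun a => hL (Fin.zero_le _)) (fun m => by
        have := ht (m + 1)
        rw [Fin.sum_univ_succ] at this
        simpa using this)
    rw [Fin.sum_univ_succ] at h0 ⊢
    rw [Fin.sum_univ_succ (fun a => c a * L a)]
    nlinarith [hB 0]

lemma det_eq_minor {m : Type} [Fintype m] [DecidableEq m] (N : Matrix (Fin n) m ℂ) (D : Fin n → ℝ)
    (e : m → Fin n) (he : Function.Bijective e) :
    ‖(N.submatrix e id).det‖ ^ 2 * ∏ x, D (e x) =
      (Nᴴ * diagonal (fun a => (D a : ℂ)) * N).det.re := by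
  let E := Equiv.ofBijective e he
  have h1 : Nᴴ * diagonal (fun a => (D a : ℂ)) * N =
      (N.submatrix e id)ᴴ * diagonal (fun x => (D (e x) : ℂ)) * (N.submatrix e id) := by
    ext x y
    rw [Matrix.mul_apply, Matrix.mul_apply]
    simp only [mul_diagonal, conjTranspose_apply, submatrix_apply, id]
    exact (Equiv.sum_comp E (fun a => star (N a x) * (D a : ℂ) * N a y)).symm
  have h2 : (∏ x, (D (e x) : ℂ)) = ((∏ x, D (e x) : ℝ) : ℂ) := by push_cast; rfl
  rw [h1, Matrix.det_mul, Matrix.det_mul, mul_right_comm, Matrix.det_conjTranspose, mul_comm (star _),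
    Complex.star_def, Complex.mul_conj, Complex.re_ofReal_mul, Complex.normSq_eq_norm_sq, det_diagonal, h2,
    Complex.ofReal_re]

lemma blk_conj (v g : Matrix (Fin n) (Fin n) ℂ) (D : Fin n → ℝ) (i : Fin n) :
    blk (gᴴ * (vᴴ * diagonal (fun a => (D a : ℂ)) * v) * g) i =
      (v * colz g i)ᴴ * diagonal (fun a => (D a : ℂ)) * (v * colz g i) := by
  have : blk (gᴴ * (vᴴ * diagonal (fun a => (D a : ℂ)) * v) * g) i =
    (colz g i)ᴴ * (vᴴ * diagonal (fun a => (D a : ℂ)) * v) * colz g i := rfl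
  rw [this]
  simp only [conjTranspose_mul, Matrix.mul_assoc]

lemma tail_nonpos (γ : κ → Fin n → ℝ) (h g : κ → Matrix (Fin n) (Fin n) ℂ) (hg : ∀ k, h k * g k = 1)
    (hS : Sst γ h) (v : Matrix (Fin n) (Fin n) ℂ) (m : ℕ) :
    ∑ k, ∑ i, γ k i * (Module.finrank ℂ (LinearMap.ker ((v * colz (g k) i).submatrix
      (fun a : {a : Fin n // a.val < m} => a.1) id).mulVecLin) : ℝ) ≤ 0 := by
  have hg' : ∀ k, g k * h k = 1 := fun k => mul_eq_one_comm.1 (hg k)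
  let V : Submodule ℂ (Fin n → ℂ) := LinearMap.ker (v.submatrix (fun a : {a : Fin n // a.val < m} => a.1) id).mulVecLin
  let W := fun k i => LinearMap.ker ((v * colz (g k) i).submatrix
      (fun a : {a : Fin n // a.val < m} => a.1) id).mulVecLin
  have hgh : ∀ k i (y : {j : Fin n // j ≤ i} → ℂ), h k *ᵥ (colz (g k) i *ᵥ y) =
      fun j => if hj : j ≤ i then y ⟨j, hj⟩ else 0 := by
    intro k i y
    have : h k * colz (g k) i = colz 1 i := by
      rw [← hg k]; rfl
    rw [mulVec_mulVec, this]
    ext j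
    simp only [mulVec, dotProduct, colz, submatrix_apply, id, Matrix.one_apply, ite_mul, one_mul, zero_mul]
    split_ifs with hj
    · rw [Finset.sum_eq_single ⟨j, hj⟩]
      · simp
      · intro b _ hb; rw [if_neg]; intro h; exact hb (Subtype.ext h.symm)
      · simp
    · apply Finset.sum_eq_zero
      intro b _; rw [if_neg]; rintro rfl; exact hj b.2
  have hinj : ∀ k i, Function.Injective (colz (g k) i).mulVecLin := by
    intro k i x y hxy
    have h1 : colz (g k) i *ᵥ x = colz (g k) i *ᵥ y := hxy
    have h2 := congrArg (h k *ᵥ ·) h1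
    simp only [hgh] at h2
    ext j
    have := congrFun h2 j.1
    simpa [j.2] using this
  have hW : ∀ k i, Module.finrank ℂ (Submodule.map (colz (g k) i).mulVecLin (W k i)) = Module.finrank ℂ (W k i) :=
    fun k i => (LinearEquiv.finrank_eq (Submodule.equivMapOfInjective _ (hinj k i) _)).symm
  have hWV : ∀ k i (y), y ∈ W k i ↔ colz (g k) i *ᵥ y ∈ V := by
    intro k i y
    simp only [W, V, LinearMap.mem_ker, mulVecLin_apply, mulVec_mulVec]
    rfl
  refine hS (Module.finrank ℂ V) (fun k i => Module.finrank ℂ (W k i)) ?_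
    (witC_of_sub V (fun k i => Submodule.map (colz (g k) i).mulVecLin (W k i)) rfl hW ?_ ?_)
  · intro k i hi
    have hall : ∀ j : Fin n, j ≤ i := fun j => by rw [Fin.le_def]; omega
    rw [← hW]
    have hVeq : Submodule.map (colz (g k) i).mulVecLin (W k i) = V := ?_
    · rw [hVeq]
    apply le_antisymm
    · rintro _ ⟨y, hy, rfl⟩; exact (hWV k i y).1 hy
    · intro x hx
      have : colz (g k) i *ᵥ (fun j => (h k *ᵥ x) j.1) = x := by
        have h1 := hgh k i (fun j => (h k *ᵥ x) j.1)
        simp only [hall, dif_pos] at h1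
        have h2 := congrArg (g k *ᵥ ·) h1
        simp only [mulVec_mulVec, ← Matrix.mul_assoc, hg', one_mulVec, Matrix.one_mul] at h2
        rw [h2]
      exact ⟨_, (hWV k i _).2 (by rw [this]; exact hx), this⟩
  · rintro k i _ ⟨y, hy, rfl⟩; exact (hWV k i y).1 hy
  · rintro k i _ ⟨y, hy, rfl⟩ j hj
    change (h k *ᵥ (colz (g k) i *ᵥ y)) j = 0
    rw [hgh]; exact dif_neg (not_le.2 hj)

lemma local_bound (γ : κ → Fin n → ℝ) (hγ : ∀ k i, i.val + 1 < n → 0 ≤ γ k i)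
    (h g : κ → Matrix (Fin n) (Fin n) ℂ) (hg : ∀ k, h k * g k = 1)
    (hS : Sst γ h) (htot : ∑ k, ∑ i : Fin n, γ k i * (i.val + 1) = 0)
    (v₀ : Matrix (Fin n) (Fin n) ℂ) (hv₀ : v₀ᴴ * v₀ = 1) :
    ∃ C : ℝ, ∀ᶠ v in nhds v₀, ∀ D : Fin n → ℝ, (∀ a, 0 < D a) → Antitone D →
      C ≤ fH γ g (vᴴ * diagonal (fun a => (D a : ℂ)) * v) := by
  have hinj : ∀ k i, Function.Injective (v₀ * colz (g k) i).mulVec := by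
    intro k i x y hxy
    have h1 := congrArg (((colz (h k)ᴴ i)ᴴ * v₀ᴴ) *ᵥ ·) hxy
    have h2 : (colz (h k)ᴴ i)ᴴ * v₀ᴴ * (v₀ * colz (g k) i) = 1 := by
      rw [Matrix.mul_assoc, ← Matrix.mul_assoc v₀ᴴ, hv₀, Matrix.one_mul]
      have : (colz (h k)ᴴ i)ᴴ * colz (g k) i = (h k * g k).submatrix Subtype.val Subtype.val := by
        rw [Matrix.submatrix_mul _ _ _ id _ Function.bijective_id]
        congr 1
        ext a b; simp [colz]
      rw [this, hg]
      exact Matrix.submatrix_one _ Subtype.val_injective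
    simpa only [mulVec_mulVec, h2, one_mulVec] using h1
  choose e he1 he2 he3 using fun k i => pivots (v₀ * colz (g k) i) (hinj k i)
  let mn : κ → Fin n → Matrix (Fin n) (Fin n) ℂ → ℂ := fun k i v => ((v * colz (g k) i).submatrix (e k i) id).det
  have hmn : ∀ k i, ContinuousAt (fun v => mn k i v) v₀ := by
    intro k i
    have : Continuous (fun v => mn k i v) := by fun_prop
    exact this.continuousAt
  have hlog : ∀ k i, ∀ᶠ v in nhds v₀, mn k i v ≠ 0 ∧
      γ k i * Real.log (‖mn k i v₀‖ ^ 2) - 1 < γ k i * Real.log (‖mn k i v‖ ^ 2) := by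
    intro k i
    refine ((hmn k i).eventually_ne (he2 k i)).and ?_
    have : ContinuousAt (fun v => γ k i * Real.log (‖mn k i v‖ ^ 2)) v₀ := by
      refine continuousAt_const.mul (ContinuousAt.log ((hmn k i).norm.pow 2) ?_)
      exact pow_ne_zero _ (norm_ne_zero_iff.2 (he2 k i))
    exact this.eventually (lt_mem_nhds (by linarith))
  refine ⟨∑ k, ∑ i, (γ k i * Real.log (‖mn k i v₀‖ ^ 2) - 1), ?_⟩
  have hall : ∀ᶠ v in nhds v₀, ∀ k i, mn k i v ≠ 0 ∧
      γ k i * Real.log (‖mn k i v₀‖ ^ 2) - 1 < γ k i * Real.log (‖mn k i v‖ ^ 2) :=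
    Filter.eventually_all.2 fun k => Filter.eventually_all.2 fun i => hlog k i
  filter_upwards [hall] with v hv D hD hDa
  have hterm : ∀ k i, γ k i * Real.log (‖mn k i v‖ ^ 2) + γ k i * ∑ x, Real.log (D (e k i x)) ≤
      γ k i * Real.log (blk ((g k)ᴴ * (vᴴ * diagonal (fun a => (D a : ℂ)) * v) * g k) i).det.re := by
    intro k i
    have hpos : 0 < ‖mn k i v‖ ^ 2 := pow_pos (norm_pos_iff.2 (hv k i).1) 2
    have hpr : 0 < ∏ x, D (e k i x) := Finset.prod_pos fun x _ => hD _
    rw [← mul_add, ← Real.log_prod (fun x _ => (hD _).ne'), ← Real.log_mul hpos.ne' hpr.ne', blk_conj]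
    by_cases hi : i.val + 1 = n
    · have hb : Function.Bijective (e k i) := by
        rw [Fintype.bijective_iff_injective_and_card]
        refine ⟨he1 k i, ?_⟩
        rw [Fintype.card_of_subtype Finset.univ (fun x => by
          simp only [Finset.mem_univ, true_iff, Fin.le_def]; omega)]
        simp
      exact (congrArg (fun t => γ k i * Real.log t) (det_eq_minor (v * colz (g k) i) D (e k i) hb)).le
    · refine mul_le_mul_of_nonneg_left (Real.log_le_log (mul_pos hpos hpr) ?_) (hγ k i (by omega))
      exact det_ge_minor (v * colz (g k) i) D hD (e k i) (he1 k i) (hv k i).1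
  have hab : 0 ≤ ∑ k, ∑ i, γ k i * ∑ x, Real.log (D (e k i x)) := by
    let c : Fin n → ℝ := fun a => ∑ k, ∑ i, γ k i * ∑ x, if e k i x = a then (1 : ℝ) else 0
    have hc : ∀ F : Fin n → ℝ, ∑ a, c a * F a = ∑ k, ∑ i, γ k i * ∑ x, F (e k i x) := by
      intro F
      simp only [c, Finset.sum_mul, Finset.mul_sum]
      rw [Finset.sum_comm]
      refine Finset.sum_congr rfl fun k _ => ?_
      rw [Finset.sum_comm]
      refine Finset.sum_congr rfl fun i _ => ?_
      rw [Finset.sum_comm]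
      refine Finset.sum_congr rfl fun x _ => ?_
      simp
    have htail : ∀ m : ℕ, m ≤ n → ∑ a, (if m ≤ a.val then c a else 0) =
        ∑ k, ∑ i, γ k i * (Module.finrank ℂ (LinearMap.ker ((v₀ * colz (g k) i).submatrix
          (fun a : {a : Fin n // a.val < m} => a.1) id).mulVecLin) : ℝ) := by
      intro m hm
      have := hc (fun a => if m ≤ a.val then 1 else 0)
      simp only [mul_ite, mul_one, mul_zero] at this
      rw [this]
      refine Finset.sum_congr rfl fun k _ => Finset.sum_congr rfl fun i _ => ?_
      rw [← he3 k i m hm]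
      simp
    have htail' : ∀ m : ℕ, ∑ a, (if m ≤ a.val then c a else 0) ≤ 0 := by
      intro m
      by_cases hm : m ≤ n
      · rw [htail m hm]; exact tail_nonpos γ h g hg hS v₀ m
      · apply le_of_eq; apply Finset.sum_eq_zero; intro a _; rw [if_neg]; omega
    have htot' : ∑ a, c a = 0 := by
      have := hc (fun _ => 1)
      simp only [mul_one, Finset.sum_const, Finset.card_univ, nsmul_eq_mul] at this
      rw [this, ← htot]
      refine Finset.sum_congr rfl fun k _ => Finset.sum_congr rfl fun i _ => ?_
      congr 1
      have : Fintype.card {j : Fin n // j ≤ i} = i.val + 1 := by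
        rw [Fintype.card_of_subtype (Finset.Iic i) (by simp)]; simp
      rw [this]; push_cast; rfl
    rw [← hc (fun a => Real.log (D a))]
    have hL : Antitone (fun a => Real.log (D a)) := fun a b hab => Real.log_le_log (hD _) (hDa hab)
    obtain ⟨B, hB⟩ := (Set.finite_range (fun a => Real.log (D a))).bddAbove
    have := abel_aux n c (fun a => Real.log (D a)) B hL (fun a => hB ⟨a, rfl⟩) htail'
    rw [htot', zero_mul] at this
    exact this
  calc ∑ k, ∑ i, (γ k i * Real.log (‖mn k i v₀‖ ^ 2) - 1)
      ≤ ∑ k, ∑ i, γ k i * Real.log (‖mn k i v‖ ^ 2) :=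
        Finset.sum_le_sum fun k _ => Finset.sum_le_sum fun i _ => (hv k i).2.le
    _ ≤ ∑ k, ∑ i, γ k i * Real.log (‖mn k i v‖ ^ 2) + ∑ k, ∑ i, γ k i * ∑ x, Real.log (D (e k i x)) := by linarith
    _ ≤ _ := by
      rw [← Finset.sum_add_distrib]
      simp only [← Finset.sum_add_distrib]
      exact Finset.sum_le_sum fun k _ => Finset.sum_le_sum fun i _ => hterm k i

lemma compact_unitary : IsCompact {v : Matrix (Fin n) (Fin n) ℂ | vᴴ * v = 1} := by
  have hcl : IsClosed {v : Matrix (Fin n) (Fin n) ℂ | vᴴ * v = 1} :=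
    isClosed_eq (by fun_prop) continuous_const
  have hK : IsCompact (Set.pi Set.univ fun _ : Fin n => Set.pi Set.univ fun _ : Fin n => Metric.closedBall (0 : ℂ) 1) :=
    isCompact_univ_pi fun _ => isCompact_univ_pi fun _ => isCompact_closedBall _ _
  refine hK.of_isClosed_subset hcl ?_
  intro v hv i _ j _
  rw [mem_closedBall_zero_iff]
  exact entry_norm_bound_of_unitary (𝕜 := ℂ) (U := v) (mem_unitaryGroup_iff'.2 hv) i j

lemma f_bdd (γ : κ → Fin n → ℝ) (hγ : ∀ k i, i.val + 1 < n → 0 ≤ γ k i)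
    (h g : κ → Matrix (Fin n) (Fin n) ℂ) (hg : ∀ k, h k * g k = 1)
    (hS : Sst γ h) (htot : ∑ k, ∑ i : Fin n, γ k i * (i.val + 1) = 0) :
    ∃ C : ℝ, ∀ H : Matrix (Fin n) (Fin n) ℂ, H.PosDef → C ≤ fH γ g H := by
  have key : ∃ C : ℝ, ∀ v ∈ {v : Matrix (Fin n) (Fin n) ℂ | vᴴ * v = 1}, ∀ D : Fin n → ℝ, (∀ a, 0 < D a) → Antitone D →
      C ≤ fH γ g (vᴴ * diagonal (fun a => (D a : ℂ)) * v) := by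
    refine compact_unitary.induction_on (p := fun s => ∃ C : ℝ, ∀ v ∈ s, ∀ D : Fin n → ℝ, (∀ a, 0 < D a) → Antitone D →
      C ≤ fH γ g (vᴴ * diagonal (fun a => (D a : ℂ)) * v)) ⟨0, by simp⟩ ?_ ?_ ?_
    · rintro s t hst ⟨C, hC⟩
      exact ⟨C, fun v hv => hC v (hst hv)⟩
    · rintro s t ⟨C, hC⟩ ⟨C', hC'⟩
      refine ⟨min C C', fun v hv D h1 h2 => ?_⟩
      rcases hv with hv | hv
      · exact (min_le_left _ _).trans (hC v hv D h1 h2)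
      · exact (min_le_right _ _).trans (hC' v hv D h1 h2)
    · intro v hv
      obtain ⟨C, hC⟩ := local_bound γ hγ h g hg hS htot v hv
      exact ⟨_, mem_nhdsWithin_of_mem_nhds hC, C, fun v hv => hv⟩
  obtain ⟨C, hC⟩ := key
  refine ⟨C, fun H hH => ?_⟩
  obtain ⟨u, hu, ha, hu2⟩ := spectral_sorted H hH.1
  have := hC uᴴ (by rw [Set.mem_ofPred_eq, conjTranspose_conjTranspose]; exact mul_eq_one_comm.1 hu) (eigsDesc hH.1)
    (fun a => hH.eigenvalues_pos _) ha
  rw [conjTranspose_conjTranspose, ← hu2] at this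
  exact this

end PartC1



section PartC2
open scoped ComplexOrder
variable {n : ℕ} {κ : Type} [Fintype κ]

lemma det_deriv {m : Type} [Fintype m] [DecidableEq m] (B : Matrix m m ℂ) :
    HasDerivAt (fun s : ℝ => ((1 + (s : ℂ) • B).det).re) B.trace.re 0 := by
  apply HasDerivAt.real_of_complex (e := fun s : ℂ => (1 + s • B).det)
  have hf : (fun s : ℂ => (1 + s • B).det) = fun s => 1 + B.trace * s +
      (1 + (Polynomial.X : Polynomial ℂ) • B.map Polynomial.C).det.divX.divX.eval s * s ^ 2 :=
    funext fun s => det_one_add_smul s B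
  rw [hf, Complex.ofReal_zero]
  set p := (1 + (Polynomial.X : Polynomial ℂ) • B.map ⇑Polynomial.C).det.divX.divX
  have h1 := ((hasDerivAt_id (0 : ℂ)).const_mul B.trace).const_add 1
  have h2 := (p.hasDerivAt 0).mul ((hasDerivAt_id (0 : ℂ)).pow 2)
  have := h1.add h2
  refine this.congr_deriv ?_
  simp

lemma blk_colz (T M : Matrix (Fin n) (Fin n) ℂ) (i : Fin n) :
    blk (Tᴴ * M * T) i = (colz T i)ᴴ * M * colz T i := rfl

lemma blk_tri (T M : Matrix (Fin n) (Fin n) ℂ) (hT : ∀ a b, b < a → T a b = 0) (i : Fin n) :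
    blk (Tᴴ * M * T) i = (blk T i)ᴴ * blk M i * blk T i := by
  have h1 : colz T i = colz 1 i * blk T i := by
    ext a b
    simp only [Matrix.mul_apply, colz, blk, submatrix_apply, id, Matrix.one_apply, ite_mul, one_mul, zero_mul]
    by_cases ha : a ≤ i
    · rw [Finset.sum_eq_single ⟨a, ha⟩]
      · simp
      · intro c _ hc; rw [if_neg]; intro h; exact hc (Subtype.ext h.symm)
      · simp
    · rw [hT a b (lt_of_le_of_lt b.2 (not_le.1 ha))]
      symm
      apply Finset.sum_eq_zero
      intro c _; rw [if_neg]; rintro rfl; exact ha c.2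
  have h2 : blk M i = (colz 1 i)ᴴ * M * colz 1 i := by
    rw [← blk_colz]; simp
  rw [blk_colz, h1, h2]
  simp only [conjTranspose_mul, Matrix.mul_assoc]

lemma posDef_sq (x : Matrix (Fin n) (Fin n) ℂ) (hx : x.det ≠ 0) : (xᴴ * x).PosDef :=
  PosDef.conjTranspose_mul_self x (mulVec_injective_of_isUnit
    ((isUnit_iff_isUnit_det _).2 (isUnit_iff_ne_zero.2 hx)))

lemma blk_det_pos (g H : Matrix (Fin n) (Fin n) ℂ) (hg : g.det ≠ 0) (hH : H.PosDef) (i : Fin n) :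
    0 < (blk (gᴴ * H * g) i).det.re := by
  have h1 : (gᴴ * H * g).PosDef := hH.conjTranspose_mul_mul_same (mulVec_injective_of_isUnit
    ((isUnit_iff_isUnit_det _).2 (isUnit_iff_ne_zero.2 hg)))
  have h2 : (blk (gᴴ * H * g) i).PosDef := h1.submatrix Subtype.val_injective
  exact (Complex.lt_def.1 h2.det_pos).1

/-- the regularised function -/
noncomputable def Ph (γ : κ → Fin n → ℝ) (g : κ → Matrix (Fin n) (Fin n) ℂ) (ε : ℝ)
    (H : Matrix (Fin n) (Fin n) ℂ) : ℝ :=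
  fH γ g H - ε * Real.log H.det.re + ε * n * Real.log H.trace.re

lemma det_sq (x : Matrix (Fin n) (Fin n) ℂ) : (xᴴ * x).det.re = ‖x.det‖ ^ 2 := by
  rw [det_mul, det_conjTranspose, mul_comm, Complex.star_def, Complex.mul_conj, Complex.normSq_eq_norm_sq,
    Complex.ofReal_re]

lemma trace_sq (x : Matrix (Fin n) (Fin n) ℂ) : (xᴴ * x).trace.re = ∑ j, ∑ i, ‖x i j‖ ^ 2 := by
  simp only [trace, Matrix.mul_apply, diag_apply, Complex.re_sum, conjTranspose_apply]
  refine Finset.sum_congr rfl fun j _ => Finset.sum_congr rfl fun i _ => ?_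
  rw [mul_comm, Complex.star_def, Complex.mul_conj, Complex.normSq_eq_norm_sq, Complex.ofReal_re]

lemma trace_pos (hn : 0 < n) (H : Matrix (Fin n) (Fin n) ℂ) (hH : H.PosDef) : 0 < H.trace.re := by
  have : Nonempty (Fin n) := ⟨⟨0, hn⟩⟩
  exact (Complex.lt_def.1 hH.trace_pos).1

lemma Ph_smul (hn : 0 < n) (γ : κ → Fin n → ℝ) (g : κ → Matrix (Fin n) (Fin n) ℂ) (ε : ℝ)
    (hg : ∀ k, (g k).det ≠ 0) (htot : ∑ k, ∑ i : Fin n, γ k i * (i.val + 1) = 0)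
    (H : Matrix (Fin n) (Fin n) ℂ) (hH : H.PosDef) (c : ℝ) (hc : 0 < c) :
    Ph γ g ε ((c : ℂ) • H) = Ph γ g ε H := by
  have h1 : fH γ g ((c : ℂ) • H) = fH γ g H := by
    have : ∀ k i, γ k i * Real.log (blk ((g k)ᴴ * ((c : ℂ) • H) * g k) i).det.re =
        γ k i * (i.val + 1) * Real.log c + γ k i * Real.log (blk ((g k)ᴴ * H * g k) i).det.re := by
      intro k i
      have e1 : blk ((g k)ᴴ * ((c : ℂ) • H) * g k) i = (c : ℂ) • blk ((g k)ᴴ * H * g k) i := by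
        rw [Matrix.mul_smul, Matrix.smul_mul]; rfl
      have e2 : Fintype.card {j : Fin n // j ≤ i} = i.val + 1 := by
        rw [Fintype.card_of_subtype (Finset.Iic i) (by simp)]; simp
      rw [e1, det_smul, e2, ← Complex.ofReal_pow, Complex.re_ofReal_mul,
        Real.log_mul (pow_pos hc _).ne' (blk_det_pos _ _ (hg k) hH i).ne', Real.log_pow]
      push_cast; ring
    simp only [fH, this, Finset.sum_add_distrib, ← Finset.sum_mul, htot, zero_mul, zero_add]
  have hd : 0 < H.det.re := (Complex.lt_def.1 hH.det_pos).1
  have ht := trace_pos hn H hH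
  rw [Ph, Ph, h1, det_smul, ← Complex.ofReal_pow, Complex.re_ofReal_mul, trace_smul, smul_eq_mul,
    Complex.re_ofReal_mul, Real.log_mul (pow_pos hc _).ne' hd.ne', Real.log_mul hc.ne' ht.ne', Real.log_pow,
    Fintype.card_fin]
  ring

lemma cont_blk (g : Matrix (Fin n) (Fin n) ℂ) (i : Fin n) :
    Continuous (fun x : Matrix (Fin n) (Fin n) ℂ => (blk (gᴴ * (xᴴ * x) * g) i).det.re) := by
  have h1 : Continuous (fun x : Matrix (Fin n) (Fin n) ℂ => gᴴ * (xᴴ * x) * g) :=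
    (continuous_const.matrix_mul (continuous_id.matrix_conjTranspose.matrix_mul continuous_id)).matrix_mul
      continuous_const
  exact Complex.continuous_re.comp (h1.matrix_submatrix _ _).matrix_det

lemma cont_tr :
    Continuous (fun x : Matrix (Fin n) (Fin n) ℂ => (xᴴ * x).trace.re) :=
  Complex.continuous_re.comp (continuous_id.matrix_conjTranspose.matrix_mul continuous_id).matrix_trace

lemma cont_det :
    Continuous (fun x : Matrix (Fin n) (Fin n) ℂ => (xᴴ * x).det.re) :=
  Complex.continuous_re.comp (continuous_id.matrix_conjTranspose.matrix_mul continuous_id).matrix_det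

lemma cont_ndet :
    Continuous (fun x : Matrix (Fin n) (Fin n) ℂ => ‖x.det‖ ^ 2) :=
  (continuous_id.matrix_det.norm).pow 2

lemma compact_slice (δ : ℝ) :
    IsCompact {x : Matrix (Fin n) (Fin n) ℂ | (xᴴ * x).trace.re = 1 ∧ δ ≤ ‖x.det‖ ^ 2} := by
  have hcl : IsClosed {x : Matrix (Fin n) (Fin n) ℂ | (xᴴ * x).trace.re = 1 ∧ δ ≤ ‖x.det‖ ^ 2} := (isClosed_eq cont_tr continuous_const).inter
    (isClosed_le continuous_const cont_ndet)
  have hB : IsCompact (Set.pi Set.univ fun _ : Fin n => Set.pi Set.univ fun _ : Fin n => Metric.closedBall (0 : ℂ) 1) :=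
    isCompact_univ_pi fun _ => isCompact_univ_pi fun _ => isCompact_closedBall _ _
  refine hB.of_isClosed_subset hcl ?_
  intro v hv i _ j _
  rw [mem_closedBall_zero_iff]
  have h1 := trace_sq v
  have h2 : ‖v i j‖ ^ 2 ≤ ∑ i, ‖v i j‖ ^ 2 :=
    Finset.single_le_sum (f := fun i => ‖v i j‖ ^ 2) (fun _ _ => sq_nonneg _) (Finset.mem_univ i)
  have h3 : ∑ i, ‖v i j‖ ^ 2 ≤ ∑ j, ∑ i, ‖v i j‖ ^ 2 :=
    Finset.single_le_sum (f := fun j => ∑ i, ‖v i j‖ ^ 2)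
      (fun _ _ => Finset.sum_nonneg fun _ _ => sq_nonneg _) (Finset.mem_univ j)
  have h4 := h1.symm.trans hv.1
  have h5 : ‖v i j‖ ^ 2 ≤ 1 := by linarith
  exact (sq_le_one_iff₀ (norm_nonneg _)).1 h5

lemma cont_Ph (γ : κ → Fin n → ℝ) (g : κ → Matrix (Fin n) (Fin n) ℂ) (ε : ℝ) (hg : ∀ k, (g k).det ≠ 0)
    (K : Set (Matrix (Fin n) (Fin n) ℂ)) (hKd : ∀ x ∈ K, x.det ≠ 0) (hK1 : ∀ x ∈ K, (xᴴ * x).trace.re = 1) :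
    ContinuousOn (fun x => Ph γ g ε (xᴴ * x)) K := by
  unfold Ph fH
  refine ((continuousOn_finsetSum _ fun k _ => continuousOn_finsetSum _ fun i _ =>
    continuousOn_const.mul ?_).sub (continuousOn_const.mul ?_)).add (continuousOn_const.mul ?_)
  · exact (cont_blk (g k) i).continuousOn.log fun x hx => (blk_det_pos _ _ (hg k) (posDef_sq x (hKd x hx)) i).ne'
  · refine cont_det.continuousOn.log fun x hx => ?_
    rw [det_sq]; exact pow_ne_zero _ (norm_ne_zero_iff.2 (hKd x hx))
  · refine cont_tr.continuousOn.log fun x hx => ?_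
    rw [hK1 x hx]; exact one_ne_zero

lemma min_exists (hn : 0 < n) (γ : κ → Fin n → ℝ) (g : κ → Matrix (Fin n) (Fin n) ℂ) (ε : ℝ) (hε : 0 < ε)
    (hg : ∀ k, (g k).det ≠ 0) (htot : ∑ k, ∑ i : Fin n, γ k i * (i.val + 1) = 0) (C : ℝ)
    (hC : ∀ H : Matrix (Fin n) (Fin n) ℂ, H.PosDef → C ≤ fH γ g H) :
    ∃ x : Matrix (Fin n) (Fin n) ℂ, x.det ≠ 0 ∧ ∀ y : Matrix (Fin n) (Fin n) ℂ, y.det ≠ 0 →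
      Ph γ g ε (xᴴ * x) ≤ Ph γ g ε (yᴴ * y) := by
  have hnorm : ∀ y : Matrix (Fin n) (Fin n) ℂ, y.det ≠ 0 → ∃ z : Matrix (Fin n) (Fin n) ℂ, z.det ≠ 0 ∧
      (zᴴ * z).trace.re = 1 ∧ Ph γ g ε (zᴴ * z) = Ph γ g ε (yᴴ * y) := by
    intro y hy
    have ht := trace_pos hn _ (posDef_sq y hy)
    set t := (yᴴ * y).trace.re with htdef
    have hs := Real.sqrt_pos.2 ht
    have e1 : (((Real.sqrt t)⁻¹ : ℝ) : ℂ) ≠ 0 := by exact_mod_cast (inv_pos.2 hs).ne'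
    have e2 : ((((Real.sqrt t)⁻¹ : ℝ) : ℂ) • y)ᴴ * ((((Real.sqrt t)⁻¹ : ℝ) : ℂ) • y) = ((t⁻¹ : ℝ) : ℂ) • (yᴴ * y) := by
      rw [conjTranspose_smul, Matrix.smul_mul, Matrix.mul_smul, smul_smul, Complex.star_def, Complex.conj_ofReal,
        ← Complex.ofReal_mul, ← mul_inv, Real.mul_self_sqrt ht.le]
    refine ⟨(((Real.sqrt t)⁻¹ : ℝ) : ℂ) • y, ?_, ?_, ?_⟩
    · rw [det_smul]; exact mul_ne_zero (pow_ne_zero _ e1) hy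
    · rw [e2, trace_smul, smul_eq_mul, Complex.re_ofReal_mul, ← htdef, inv_mul_cancel₀ ht.ne']
    · rw [e2]; exact Ph_smul hn γ g ε hg htot _ (posDef_sq y hy) _ (inv_pos.2 ht)
  obtain ⟨x1, hx1, hx1t, -⟩ := hnorm 1 (by simp)
  set M := Ph γ g ε (x1ᴴ * x1)
  let δ := Real.exp ((C - M) / ε)
  have hδ : 0 < δ := Real.exp_pos _
  have hlow : ∀ y : Matrix (Fin n) (Fin n) ℂ, y.det ≠ 0 → (yᴴ * y).trace.re = 1 → Ph γ g ε (yᴴ * y) ≤ M →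
      δ ≤ ‖y.det‖ ^ 2 := by
    intro y hy ht hM
    have h1 := hC _ (posDef_sq y hy)
    rw [Ph, ht, Real.log_one, det_sq] at hM
    have hp : 0 < ‖y.det‖ ^ 2 := pow_pos (norm_pos_iff.2 hy) 2
    rw [← Real.le_log_iff_exp_le hp, div_le_iff₀ hε]
    nlinarith
  let K : Set (Matrix (Fin n) (Fin n) ℂ) := {x | (xᴴ * x).trace.re = 1 ∧ δ ≤ ‖x.det‖ ^ 2}
  have hKc : IsCompact K := compact_slice δ
  have hKd : ∀ x ∈ K, x.det ≠ 0 := by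
    intro x hx h0
    have := hx.2
    rw [h0] at this
    simp at this
    linarith
  have hcont : ContinuousOn (fun x => Ph γ g ε (xᴴ * x)) K := cont_Ph γ g ε hg K hKd (fun x hx => hx.1)
  have hx1K : x1 ∈ K := ⟨hx1t, hlow x1 hx1 hx1t le_rfl⟩
  obtain ⟨x, hxK, hx⟩ := hKc.exists_isMinOn ⟨x1, hx1K⟩ hcont
  refine ⟨x, hKd x hxK, fun y hy => ?_⟩
  obtain ⟨z, hz, hzt, hze⟩ := hnorm y hy
  rw [← hze]
  by_cases hM : Ph γ g ε (zᴴ * z) ≤ M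
  · exact hx (a := z) ⟨hzt, hlow z hz hzt hM⟩
  · exact (hx (a := x1) hx1K).trans (not_le.1 hM).le

lemma factor_small (S x : Matrix (Fin n) (Fin n) ℂ) (hS : S.IsHermitian) (hx : x.det ≠ 0) :
    ∀ᶠ s : ℝ in nhds 0, ∃ y : Matrix (Fin n) (Fin n) ℂ, y.det ≠ 0 ∧ yᴴ * y = xᴴ * (1 + (s : ℂ) • S) * x := by
  obtain ⟨w, hw, -, hw2⟩ := spectral_sorted S hS
  have hw' : w * wᴴ = 1 := mul_eq_one_comm.1 hw
  set l := eigsDesc hS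
  have hev : ∀ᶠ s : ℝ in nhds 0, ∀ a, 0 < 1 + s * l a := by
    refine Filter.eventually_all.2 fun a => ?_
    have : ContinuousAt (fun s : ℝ => 1 + s * l a) 0 := by fun_prop
    exact this.eventually (lt_mem_nhds (by simp))
  filter_upwards [hev] with s hs
  let Dg : Matrix (Fin n) (Fin n) ℂ := diagonal fun a => ((Real.sqrt (1 + s * l a) : ℝ) : ℂ)
  refine ⟨Dg * wᴴ * x, ?_, ?_⟩
  · rw [det_mul, det_mul]
    refine mul_ne_zero (mul_ne_zero ?_ ?_) hx
    · rw [det_diagonal, Finset.prod_ne_zero_iff]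
      intro a _
      exact_mod_cast (Real.sqrt_pos.2 (hs a)).ne'
    · intro h0
      have := congrArg det hw
      rw [det_mul, h0] at this
      simp at this
  · have hD : Dgᴴ * Dg = 1 + (s : ℂ) • diagonal (fun a => (l a : ℂ)) := by
      simp only [Dg]
      rw [diagonal_conjTranspose, diagonal_mul_diagonal, ← diagonal_one, ← diagonal_smul, diagonal_add]
      congr 1
      ext a
      simp only [Pi.star_apply, Complex.star_def, Complex.conj_ofReal, Pi.smul_apply, smul_eq_mul]
      rw [← Complex.ofReal_mul, Real.mul_self_sqrt (hs a).le]
      push_cast; rfl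
    calc (Dg * wᴴ * x)ᴴ * (Dg * wᴴ * x) = xᴴ * (w * (Dgᴴ * Dg) * wᴴ) * x := by
          simp only [conjTranspose_mul, conjTranspose_conjTranspose, Matrix.mul_assoc]
      _ = _ := by
          rw [hD, Matrix.mul_add, Matrix.add_mul, Matrix.mul_one, hw', Matrix.mul_smul, Matrix.smul_mul, ← hw2]

lemma Ph_deriv (hn : 0 < n) (γ : κ → Fin n → ℝ) (g : κ → Matrix (Fin n) (Fin n) ℂ) (ε : ℝ)
    (x S : Matrix (Fin n) (Fin n) ℂ) (hx : x.det ≠ 0)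
    (T : κ → Matrix (Fin n) (Fin n) ℂ) (hT : ∀ k a b, b < a → T k a b = 0)
    (hu : ∀ k, (x * g k * T k)ᴴ * (x * g k * T k) = 1) :
    HasDerivAt (fun s : ℝ => Ph γ g ε (xᴴ * (1 + (s : ℂ) • S) * x))
      (∑ k, ∑ i, γ k i * (blk ((x * g k * T k)ᴴ * S * (x * g k * T k)) i).trace.re - ε * S.trace.re
        + ε * n * ((xᴴ * S * x).trace.re / (xᴴ * x).trace.re)) 0 := by
  unfold Ph fH
  have hblk : ∀ k i, HasDerivAt (fun s : ℝ => Real.log (blk ((g k)ᴴ * (xᴴ * (1 + (s : ℂ) • S) * x) * g k) i).det.re)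
      (blk ((x * g k * T k)ᴴ * S * (x * g k * T k)) i).trace.re 0 := by
    intro k i
    set u := x * g k * T k with hudef
    have h1 : ∀ s : ℝ, ‖(blk (T k) i).det‖ ^ 2 * (blk ((g k)ᴴ * (xᴴ * (1 + (s : ℂ) • S) * x) * g k) i).det.re =
        (1 + (s : ℂ) • blk (uᴴ * S * u) i).det.re := by
      intro s
      have e1 : (T k)ᴴ * ((g k)ᴴ * (xᴴ * (1 + (s : ℂ) • S) * x) * g k) * T k = 1 + (s : ℂ) • (uᴴ * S * u) := by
        calc _ = uᴴ * (1 + (s : ℂ) • S) * u := by simp only [hudef, conjTranspose_mul, Matrix.mul_assoc]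
          _ = _ := by rw [Matrix.mul_add, Matrix.add_mul, Matrix.mul_one, hu, Matrix.mul_smul, Matrix.smul_mul]
      have e2 : blk (1 + (s : ℂ) • (uᴴ * S * u)) i = 1 + (s : ℂ) • blk (uᴴ * S * u) i := by
        ext a b
        simp [blk, Matrix.one_apply, Subtype.ext_iff]
      rw [← e2, ← e1, blk_tri _ _ (hT k), det_mul, det_mul, mul_right_comm, det_conjTranspose, mul_comm (star _),
        Complex.star_def, Complex.mul_conj, Complex.re_ofReal_mul, Complex.normSq_eq_norm_sq]
    have hne : ‖(blk (T k) i).det‖ ^ 2 ≠ 0 := by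
      intro h0
      have := h1 0
      rw [h0] at this
      simp at this
    have h2 : ∀ s : ℝ, (blk ((g k)ᴴ * (xᴴ * (1 + (s : ℂ) • S) * x) * g k) i).det.re =
        (‖(blk (T k) i).det‖ ^ 2)⁻¹ * (1 + (s : ℂ) • blk (uᴴ * S * u) i).det.re := by
      intro s; rw [← h1]; exact (inv_mul_cancel_left₀ hne _).symm
    simp only [h2]
    have h3 := ((det_deriv (blk (uᴴ * S * u) i)).const_mul (‖(blk (T k) i).det‖ ^ 2)⁻¹).log (by simpa using hne)
    refine h3.congr_deriv ?_
    have hz : (1 + ((0 : ℝ) : ℂ) • blk (uᴴ * S * u) i).det.re = 1 := by simp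
    rw [hz, mul_one, mul_div_cancel_left₀ _ (inv_ne_zero hne)]
  have hdet : HasDerivAt (fun s : ℝ => Real.log (xᴴ * (1 + (s : ℂ) • S) * x).det.re) S.trace.re 0 := by
    have hne : ‖x.det‖ ^ 2 ≠ 0 := pow_ne_zero _ (norm_ne_zero_iff.2 hx)
    have h2 : ∀ s : ℝ, (xᴴ * (1 + (s : ℂ) • S) * x).det.re = ‖x.det‖ ^ 2 * (1 + (s : ℂ) • S).det.re := by
      intro s
      rw [det_mul, det_mul, mul_right_comm, det_conjTranspose, mul_comm (star _),
        Complex.star_def, Complex.mul_conj, Complex.re_ofReal_mul, Complex.normSq_eq_norm_sq]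
    simp only [h2]
    have h3 := ((det_deriv S).const_mul (‖x.det‖ ^ 2)).log (by simpa using hx)
    refine h3.congr_deriv ?_
    have hz : (1 + ((0 : ℝ) : ℂ) • S).det.re = 1 := by simp
    rw [hz, mul_one, mul_div_cancel_left₀ _ hne]
  have htr : HasDerivAt (fun s : ℝ => Real.log (xᴴ * (1 + (s : ℂ) • S) * x).trace.re)
      ((xᴴ * S * x).trace.re / (xᴴ * x).trace.re) 0 := by
    have h2 : ∀ s : ℝ, (xᴴ * (1 + (s : ℂ) • S) * x).trace.re = (xᴴ * x).trace.re + s * (xᴴ * S * x).trace.re := by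
      intro s
      rw [Matrix.mul_add, Matrix.add_mul, Matrix.mul_one, Matrix.mul_smul, Matrix.smul_mul, trace_add, trace_smul,
        smul_eq_mul, Complex.add_re, Complex.re_ofReal_mul]
    simp only [h2]
    have h3 := (((hasDerivAt_id (0 : ℝ)).mul_const (xᴴ * S * x).trace.re).const_add (xᴴ * x).trace.re).log
      (by simpa using (trace_pos hn _ (posDef_sq x hx)).ne')
    refine h3.congr_deriv ?_
    simp
  exact ((HasDerivAt.fun_sum fun k _ => HasDerivAt.fun_sum fun i _ => (hblk k i).const_mul _).sub
    (hdet.const_mul _)).add (htr.const_mul _)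

lemma sum_blk_trace (γ : Fin n → ℝ) (M : Matrix (Fin n) (Fin n) ℂ) :
    ∑ i, γ i * (blk M i).trace.re = (M * diagonal (fun a => (lamOf γ a : ℂ))).trace.re := by
  have h1 : ∀ i, (blk M i).trace.re = ∑ a, if a ≤ i then (M a a).re else 0 := by
    intro i
    rw [← Finset.sum_filter, trace, Complex.re_sum]
    exact (Finset.sum_subtype (p := fun a => a ≤ i) (Finset.univ.filter (fun a => a ≤ i)) (by simp)
      (fun a => (M a a).re)).symm
  simp only [h1]
  simp only [trace, diag_apply, mul_diagonal, Complex.re_sum, Complex.re_mul_ofReal, lamOf, Finset.mul_sum]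
  rw [Finset.sum_comm]
  refine Finset.sum_congr rfl fun a _ => Finset.sum_congr rfl fun i _ => ?_
  split_ifs
  · ring
  · simp

end PartC2



section Final
open scoped ComplexOrder
variable {n : ℕ} {κ : Type} [Fintype κ]

/-- sum of the Hermitian matrices with prescribed spectra -/
noncomputable def Sof (μ : κ → Fin n → ℝ) (u : κ → Matrix (Fin n) (Fin n) ℂ) : Matrix (Fin n) (Fin n) ℂ :=
  ∑ k, u k * diagonal (fun a => (μ k a : ℂ)) * (u k)ᴴ

lemma diag_herm (l : Fin n → ℝ) (u : Matrix (Fin n) (Fin n) ℂ) :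
    (u * diagonal (fun a => (l a : ℂ)) * uᴴ).IsHermitian := by
  have : (diagonal (fun a => (l a : ℂ)))ᴴ = diagonal (fun a => (l a : ℂ)) := by
    rw [diagonal_conjTranspose]; congr 1; ext a; simp
  simp only [IsHermitian, conjTranspose_mul, conjTranspose_conjTranspose, this, Matrix.mul_assoc]

lemma Sof_herm (μ : κ → Fin n → ℝ) (u : κ → Matrix (Fin n) (Fin n) ℂ) : (Sof μ u).IsHermitian := by
  unfold Sof IsHermitian
  rw [conjTranspose_sum]
  exact Finset.sum_congr rfl fun k _ => (diag_herm (μ k) (u k)).eq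

lemma Sof_trace (γ : κ → Fin n → ℝ) (u : κ → Matrix (Fin n) (Fin n) ℂ) (hu : ∀ k, (u k)ᴴ * u k = 1) :
    (Sof (fun k => lamOf (γ k)) u).trace.re = ∑ k, ∑ i : Fin n, γ k i * (i.val + 1) := by
  unfold Sof
  rw [trace_sum, Complex.re_sum]
  refine Finset.sum_congr rfl fun k _ => ?_
  rw [Matrix.trace_mul_comm, ← Matrix.mul_assoc, hu, ← sum_blk_trace]
  refine Finset.sum_congr rfl fun i _ => ?_
  have e2 : Fintype.card {j : Fin n // j ≤ i} = i.val + 1 := by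
    rw [Fintype.card_of_subtype (Finset.Iic i) (by simp)]; simp
  have : blk (1 : Matrix (Fin n) (Fin n) ℂ) i = 1 := Matrix.submatrix_one _ Subtype.val_injective
  rw [this, trace_one, e2]
  simp

lemma trace_lower (l : Fin n → ℝ) (Λ : ℝ) (hΛ : ∀ a, -Λ ≤ l a) (u x : Matrix (Fin n) (Fin n) ℂ)
    (hu : uᴴ * u = 1) :
    -(Λ * (xᴴ * x).trace.re) ≤ (xᴴ * (u * diagonal (fun a => (l a : ℂ)) * uᴴ) * x).trace.re := by
  have hu' : u * uᴴ = 1 := mul_eq_one_comm.1 hu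
  have h1 : (diagonal (fun a => ((l a + Λ : ℝ) : ℂ))).PosSemidef := by
    apply PosSemidef.diagonal
    intro a
    simp only [Pi.zero_apply]
    have := hΛ a
    have h2 : 0 ≤ l a + Λ := by linarith
    exact_mod_cast h2
  have h2 := (h1.conjTranspose_mul_mul_same (uᴴ * x)).trace_nonneg
  have h3 : (uᴴ * x)ᴴ * diagonal (fun a => ((l a + Λ : ℝ) : ℂ)) * (uᴴ * x) =
      xᴴ * (u * diagonal (fun a => (l a : ℂ)) * uᴴ) * x + (Λ : ℂ) • (xᴴ * x) := by
    have h4 : diagonal (fun a => ((l a + Λ : ℝ) : ℂ)) = diagonal (fun a => (l a : ℂ)) +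
        (Λ : ℂ) • (1 : Matrix (Fin n) (Fin n) ℂ) := by
      rw [← diagonal_one, ← diagonal_smul, diagonal_add]
      congr 1; ext a; simp
    rw [h4]
    calc _ = xᴴ * (u * diagonal (fun a => (l a : ℂ)) * uᴴ) * x + (Λ : ℂ) • (xᴴ * (u * uᴴ) * x) := by
          simp only [conjTranspose_mul, conjTranspose_conjTranspose, Matrix.mul_add, Matrix.add_mul,
            Matrix.mul_smul, Matrix.smul_mul, Matrix.mul_one, Matrix.mul_assoc]
      _ = _ := by rw [hu', Matrix.mul_one]
  rw [h3] at h2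
  have h5 := (Complex.le_def.1 h2).1
  rw [trace_add, trace_smul, smul_eq_mul, Complex.add_re, Complex.re_ofReal_mul, Complex.zero_re] at h5
  linarith

lemma approx_feas (hn : 0 < n) (γ : κ → Fin n → ℝ) (g : κ → Matrix (Fin n) (Fin n) ℂ)
    (hg : ∀ k, (g k).det ≠ 0) (htot : ∑ k, ∑ i : Fin n, γ k i * (i.val + 1) = 0) (C : ℝ)
    (hC : ∀ H : Matrix (Fin n) (Fin n) ℂ, H.PosDef → C ≤ fH γ g H) (ε : ℝ) (hε : 0 < ε) :
    ∃ u : κ → Matrix (Fin n) (Fin n) ℂ, (∀ k, (u k)ᴴ * u k = 1) ∧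
      (Sof (fun k => lamOf (γ k)) u * Sof (fun k => lamOf (γ k)) u).trace.re ≤
        ε * n * ∑ k, ∑ a, |lamOf (γ k) a| := by
  obtain ⟨x, hx, hmin⟩ := min_exists hn γ g ε hε hg htot C hC
  choose T hT hu using fun k => qr_exists (x * g k) (by rw [det_mul]; exact mul_ne_zero hx (hg k))
  let u : κ → Matrix (Fin n) (Fin n) ℂ := fun k => x * g k * T k
  set S := Sof (fun k => lamOf (γ k)) u with hSdef
  refine ⟨u, hu, ?_⟩
  rw [← hSdef]
  have hSh : S.IsHermitian := Sof_herm _ u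
  have hd := Ph_deriv hn γ g ε x S hx T hT hu
  have hloc : IsLocalMin (fun s : ℝ => Ph γ g ε (xᴴ * (1 + (s : ℂ) • S) * x)) 0 := by
    filter_upwards [factor_small S x hSh hx] with s hs
    obtain ⟨y, hy, hy2⟩ := hs
    have := hmin y hy
    rw [hy2] at this
    simpa using this
  have h0 := hloc.hasDerivAt_eq_zero hd
  have hS0 : S.trace.re = 0 := by rw [hSdef, Sof_trace γ u hu, htot]
  have hSS : ∑ k, ∑ i, γ k i * (blk ((x * g k * T k)ᴴ * S * (x * g k * T k)) i).trace.re = (S * S).trace.re := by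
    have : (S * S).trace.re = ∑ k, (S * (u k * diagonal (fun a => (lamOf (γ k) a : ℂ)) * (u k)ᴴ)).trace.re := by
      conv_lhs => rw [hSdef]; arg 1; arg 1; arg 2; unfold Sof
      rw [Matrix.mul_sum, trace_sum, Complex.re_sum]
    rw [this]
    refine Finset.sum_congr rfl fun k _ => ?_
    rw [sum_blk_trace]
    change ((u k)ᴴ * S * u k * _).trace.re = _
    rw [Matrix.mul_assoc, Matrix.mul_assoc, Matrix.trace_mul_comm]
    simp only [Matrix.mul_assoc]
  rw [hSS, hS0, mul_zero, sub_zero] at h0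
  have ht := trace_pos hn _ (posDef_sq x hx)
  have hlow : -((∑ k, ∑ a, |lamOf (γ k) a|) * (xᴴ * x).trace.re) ≤ (xᴴ * S * x).trace.re := by
    rw [hSdef]
    unfold Sof
    rw [Matrix.mul_sum, Matrix.sum_mul, trace_sum, Complex.re_sum, Finset.sum_mul, ← Finset.sum_neg_distrib]
    refine Finset.sum_le_sum fun k _ => trace_lower _ _ (fun a => ?_) _ _ (hu k)
    have := Finset.single_le_sum (f := fun a => |lamOf (γ k) a|) (fun _ _ => abs_nonneg _) (Finset.mem_univ a)
    have h2 := neg_abs_le (lamOf (γ k) a)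
    have h5 : |lamOf (γ k) a| ≤ ∑ a, |lamOf (γ k) a| := this
    linarith
  have h3 : -(∑ k, ∑ a, |lamOf (γ k) a|) ≤ (xᴴ * S * x).trace.re / (xᴴ * x).trace.re := by
    rw [le_div_iff₀ ht]; linarith
  have h4 : 0 ≤ ε * n := by positivity
  nlinarith [mul_le_mul_of_nonneg_left h3 h4]

/-- feasibility of a family of spectra -/
def Feas (μ : κ → Fin n → ℝ) : Prop :=
  ∃ u : κ → Matrix (Fin n) (Fin n) ℂ, (∀ k, (u k)ᴴ * u k = 1) ∧ Sof μ u = 0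

lemma partC (hn : 0 < n) (γ : κ → Fin n → ℝ) (hγ : ∀ k i, i.val + 1 < n → 0 ≤ γ k i)
    (h : κ → Matrix (Fin n) (Fin n) ℂ) (hh : ∀ k, (h k).det ≠ 0)
    (hS : Sst γ h) (htot : ∑ k, ∑ i : Fin n, γ k i * (i.val + 1) = 0) :
    Feas (fun k => lamOf (γ k)) := by
  have hg : ∀ k, h k * (h k)⁻¹ = 1 := fun k => mul_nonsing_inv _ (isUnit_iff_ne_zero.2 (hh k))
  have hgd : ∀ k, ((h k)⁻¹).det ≠ 0 := by
    intro k h0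
    have := congrArg det (hg k)
    rw [det_mul, h0] at this
    simp at this
  obtain ⟨C, hC⟩ := f_bdd γ hγ h (fun k => (h k)⁻¹) hg hS htot
  have happ := approx_feas hn γ (fun k => (h k)⁻¹) hgd htot C hC
  set S := fun u : κ → Matrix (Fin n) (Fin n) ℂ => Sof (fun k => lamOf (γ k)) u with hSdef
  let K : Set (κ → Matrix (Fin n) (Fin n) ℂ) := Set.pi Set.univ fun _ => {v | vᴴ * v = 1}
  have hK : IsCompact K := isCompact_univ_pi fun _ => compact_unitary
  have hScont : Continuous S := by
    refine continuous_finsetSum _ fun k _ => ?_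
    exact ((continuous_apply k).matrix_mul continuous_const).matrix_mul (continuous_apply k).matrix_conjTranspose
  have hcont : Continuous (fun u => (S u * S u).trace.re) :=
    Complex.continuous_re.comp (hScont.matrix_mul hScont).matrix_trace
  obtain ⟨u, huK, hmin⟩ := hK.exists_isMinOn ⟨fun _ => 1, fun k _ => by simp⟩ hcont.continuousOn
  refine ⟨u, fun k => huK k (Set.mem_univ k), ?_⟩
  have hle : (S u * S u).trace.re ≤ 0 := by
    set L := (n : ℝ) * ∑ k, ∑ a, |lamOf (γ k) a|
    have hL : 0 ≤ L := mul_nonneg (Nat.cast_nonneg _) (Finset.sum_nonneg fun _ _ => Finset.sum_nonneg fun _ _ => abs_nonneg _)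
    refine le_of_forall_pos_le_add fun η hη => ?_
    obtain ⟨w, hw, hw2⟩ := happ (η / (L + 1)) (by positivity)
    have h1 : (S u * S u).trace.re ≤ (S w * S w).trace.re := hmin (a := w) (fun k _ => hw k)
    rw [mul_assoc] at hw2
    have h2 : η / (L + 1) * L ≤ η := by
      rw [div_mul_eq_mul_div, div_le_iff₀ (by positivity)]; nlinarith
    simp only [hSdef] at h1 ⊢
    linarith
  have hh : (S u)ᴴ = S u := (Sof_herm _ u).eq
  have hnn := trace_sq (S u)
  rw [hh] at hnn
  have hz : ∑ j, ∑ i, ‖S u i j‖ ^ 2 = 0 :=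
    le_antisymm (hnn ▸ hle) (Finset.sum_nonneg fun _ _ => Finset.sum_nonneg fun _ _ => sq_nonneg _)
  change S u = 0
  ext i j
  rw [Finset.sum_eq_zero_iff_of_nonneg (fun _ _ => Finset.sum_nonneg fun _ _ => sq_nonneg _)] at hz
  have h1 := hz j (Finset.mem_univ _)
  rw [Finset.sum_eq_zero_iff_of_nonneg (fun _ _ => sq_nonneg _)] at h1
  have h2 := h1 i (Finset.mem_univ _)
  simpa using h2

lemma exists_gaps (l : Fin n → ℝ) (hl : Antitone l) :
    ∃ γ : Fin n → ℝ, lamOf γ = l ∧ ∀ i, i.val + 1 < n → 0 ≤ γ i := by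
  let γ : Fin n → ℝ := fun i => if h : i.val + 1 < n then l i - l ⟨i.val + 1, h⟩ else l i
  refine ⟨γ, ?_, ?_⟩
  · have key : ∀ m : ℕ, ∀ j : Fin n, n - j.val = m → lamOf γ j = l j := by
      intro m
      induction m with
      | zero => intro j hj; omega
      | succ m ih =>
        intro j hj
        by_cases h : j.val + 1 < n
        · have h1 := ih ⟨j.val + 1, h⟩ (by simp only; omega)
          have h2 : lamOf γ j = γ j + lamOf γ ⟨j.val + 1, h⟩ := by
            unfold lamOf
            rw [← Finset.sum_ite_eq Finset.univ j γ |>.trans (if_pos (Finset.mem_univ j)), ← Finset.sum_add_distrib]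
            refine Finset.sum_congr rfl fun i _ => ?_
            simp only [Fin.le_def, Fin.ext_iff]
            split_ifs <;> first | omega | simp
          rw [h2, h1]
          simp [γ, h]
        · unfold lamOf
          rw [Finset.sum_eq_single j]
          · simp [γ, h]
          · intro b _ hb
            rw [if_neg]
            intro hle
            rw [Fin.le_def] at hle
            exact hb (Fin.ext (by omega))
          · simp
    ext j
    exact key _ j rfl
  · intro i hi
    simp only [γ, hi, dif_pos, sub_nonneg]
    exact hl (by rw [Fin.le_def]; simp)

lemma lamOf_add (γ γ' : Fin n → ℝ) : lamOf (γ + γ') = lamOf γ + lamOf γ' := by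
  ext j
  simp only [lamOf, Pi.add_apply, ← Finset.sum_add_distrib]
  refine Finset.sum_congr rfl fun i _ => ?_
  split_ifs <;> simp

lemma feas_add (hn : 0 < n) (μ μ' : κ → Fin n → ℝ) (ha : ∀ k, Antitone (μ k)) (ha' : ∀ k, Antitone (μ' k))
    (hf : Feas μ) (hf' : Feas μ') : Feas (fun k => μ k + μ' k) := by
  choose γ h1 h2 using fun k => exists_gaps (μ k) (ha k)
  choose γ' h1' h2' using fun k => exists_gaps (μ' k) (ha' k)
  obtain rfl : (fun k => lamOf (γ k)) = μ := funext h1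
  obtain rfl : (fun k => lamOf (γ' k)) = μ' := funext h1'
  obtain ⟨u, hu, hs⟩ := hf
  obtain ⟨u', hu', hs'⟩ := hf'
  have hA := partA γ h2 u hu hs
  have hA' := partA γ' h2' u' hu' hs'
  obtain ⟨h, hh, hw⟩ := generic_exists (fun k => (u k)ᴴ) (fun k => (u' k)ᴴ) (fun k h0 => by
    have := congrArg det (hu k)
    rw [det_mul, h0] at this
    simp at this)
  have ht := Sof_trace γ u hu
  have ht' := Sof_trace γ' u' hu'
  rw [hs] at ht
  rw [hs'] at ht'
  simp only [trace_zero, Complex.zero_re] at ht ht'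
  have := partC hn (fun k => γ k + γ' k) (fun k i hi => add_nonneg (h2 k i hi) (h2' k i hi)) h hh (by
      intro r d hd hW
      have e1 := hA r d hd (hw r d hW).1
      have e2 := hA' r d hd (hw r d hW).2
      simp only [Pi.add_apply, add_mul, Finset.sum_add_distrib]
      linarith) (by
      simp only [Pi.add_apply, add_mul, Finset.sum_add_distrib]
      linarith)
  simpa only [lamOf_add] using this

/-- Horn triples in terms of spectra -/
def HornT (α β δ : Fin n → ℝ) : Prop :=
  ∃ u₁ u₂ u₃ : Matrix (Fin n) (Fin n) ℂ, (u₁ᴴ * u₁ = 1 ∧ u₂ᴴ * u₂ = 1 ∧ u₃ᴴ * u₃ = 1) ∧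
    u₁ * diagonal (fun a => (α a : ℂ)) * u₁ᴴ + u₂ * diagonal (fun a => (β a : ℂ)) * u₂ᴴ =
      u₃ * diagonal (fun a => (δ a : ℂ)) * u₃ᴴ

lemma rev_unitary (δ : Fin n → ℝ) (w : Matrix (Fin n) (Fin n) ℂ) (hw : wᴴ * w = 1) :
    ∃ w' : Matrix (Fin n) (Fin n) ℂ, w'ᴴ * w' = 1 ∧
      w' * diagonal (fun a => ((-δ a.rev : ℝ) : ℂ)) * w'ᴴ = -(w * diagonal (fun a => (δ a : ℂ)) * wᴴ) := by
  refine ⟨w.submatrix id Fin.revPerm, ?_, ?_⟩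
  · rw [conjTranspose_submatrix, ← Matrix.submatrix_mul _ _ _ id _ Function.bijective_id, hw]
    exact Matrix.submatrix_one_equiv Fin.revPerm
  · ext a b
    rw [Matrix.neg_apply, Matrix.mul_apply, Matrix.mul_apply]
    simp only [mul_diagonal, conjTranspose_apply, submatrix_apply, id]
    rw [← Equiv.sum_comp Fin.revPerm (fun c => w a c * (δ c : ℂ) * star (w b c)), ← Finset.sum_neg_distrib]
    refine Finset.sum_congr rfl fun c _ => ?_
    simp

lemma hornT_iff (α β δ : Fin n → ℝ) :
    HornT α β δ ↔ Feas (κ := Fin 3) ![α, β, fun a => -δ a.rev] := by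
  constructor
  · rintro ⟨u₁, u₂, u₃, ⟨h1, h2, h3⟩, h⟩
    obtain ⟨w, hw, hw2⟩ := rev_unitary δ u₃ h3
    refine ⟨![u₁, u₂, w], ?_, ?_⟩
    · intro k; fin_cases k
      · exact h1
      · exact h2
      · exact hw
    · simp only [Sof, Fin.sum_univ_three]
      change u₁ * diagonal (fun a => (α a : ℂ)) * u₁ᴴ + u₂ * diagonal (fun a => (β a : ℂ)) * u₂ᴴ +
        w * diagonal (fun a => ((-δ a.rev : ℝ) : ℂ)) * wᴴ = 0
      rw [h, hw2, add_neg_cancel]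
  · rintro ⟨u, hu, hs⟩
    obtain ⟨w, hw, hw2⟩ := rev_unitary (fun a => -δ a.rev) (u 2) (hu 2)
    simp only [Fin.rev_rev, neg_neg] at hw2
    refine ⟨u 0, u 1, w, ⟨hu 0, hu 1, hw⟩, ?_⟩
    simp only [Sof, Fin.sum_univ_three] at hs
    rw [hw2]
    exact eq_neg_of_add_eq_zero_left hs

lemma hornT_add (hn : 0 < n) (α β δ α' β' δ' : Fin n → ℝ) (h1 : Antitone α) (h2 : Antitone β) (h3 : Antitone δ)
    (h1' : Antitone α') (h2' : Antitone β') (h3' : Antitone δ') (h : HornT α β δ) (h' : HornT α' β' δ') :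
    HornT (α + α') (β + β') (δ + δ') := by
  rw [hornT_iff] at h h' ⊢
  have hr : ∀ δ : Fin n → ℝ, Antitone δ → Antitone (fun a : Fin n => -δ (Fin.rev a)) := fun δ hδ a b hab =>
    neg_le_neg (hδ (Fin.rev_le_rev.2 hab))
  have := feas_add hn _ _ (fun k => by
    fin_cases k
    · exact h1
    · exact h2
    · exact hr _ h3) (fun k => by
    fin_cases k
    · exact h1'
    · exact h2'
    · exact hr _ h3') h h'
  convert this using 1
  ext k a
  fin_cases k
  · rfl
  · rfl
  · simp; ring

/-- partial sums -/
noncomputable def psum (n : ℕ) : (Fin n → ℝ) →ₗ[ℝ] (Fin n → ℝ) where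
  toFun l := fun i => ∑ j ∈ Finset.Iic i, l j
  map_add' x y := by ext i; simp [Finset.sum_add_distrib]
  map_smul' c x := by ext i; simp [Finset.mul_sum]

lemma psum_inj (n : ℕ) : Function.Injective (psum n) := by
  rw [← LinearMap.ker_eq_bot, LinearMap.ker_eq_bot']
  intro l hl
  have key : ∀ m : ℕ, ∀ i : Fin n, i.val = m → l i = 0 := by
    intro m
    induction m using Nat.strong_induction_on with
    | _ m ih =>
      intro i hi
      have h1 : ∑ j ∈ Finset.Iic i, l j = 0 := congrFun hl i
      rw [Finset.sum_eq_single i] at h1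
      · exact h1
      · intro b hb hbi
        have hle := Finset.mem_Iic.1 hb
        have : b < i := lt_of_le_of_ne hle hbi
        exact ih b.val (by rw [← hi]; exact this) b rfl
      · intro h; exact absurd (Finset.mem_Iic.2 le_rfl) h
  ext i
  exact key _ i rfl

/-- spectra triples -/
def HornS (n : ℕ) : Set ((Fin n → ℝ) × (Fin n → ℝ) × (Fin n → ℝ)) :=
  {x | (Antitone x.1 ∧ Antitone x.2.1 ∧ Antitone x.2.2) ∧ HornT x.1 x.2.1 x.2.2}

lemma horn_eq (n : ℕ) :
    HornCone n = ((psum n).prodMap ((psum n).prodMap (psum n))) '' HornS n := by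
  ext ⟨a, b, c⟩
  constructor
  · rintro ⟨K₁, K₂, h₁, h₂, e1, e2, e3⟩
    obtain ⟨u₁, hu₁, ha₁, hk₁⟩ := spectral_sorted K₁ h₁
    obtain ⟨u₂, hu₂, ha₂, hk₂⟩ := spectral_sorted K₂ h₂
    obtain ⟨u₃, hu₃, ha₃, hk₃⟩ := spectral_sorted (K₁ + K₂) (h₁.add h₂)
    refine ⟨(eigsDesc h₁, eigsDesc h₂, eigsDesc (h₁.add h₂)), ⟨⟨ha₁, ha₂, ha₃⟩, u₁, u₂, u₃, ⟨hu₁, hu₂, hu₃⟩, ?_⟩, ?_⟩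
    · dsimp only
      rw [← hk₁, ← hk₂, ← hk₃]
    · exact Prod.ext e1 (Prod.ext e2 e3)
  · rintro ⟨⟨α, β, δ⟩, ⟨⟨ha, hb, hd⟩, u₁, u₂, u₃, ⟨hu₁, hu₂, hu₃⟩, h⟩, he⟩
    dsimp only at ha hb hd h
    have h₁ := diag_herm α u₁
    have h₂ := diag_herm β u₂
    have e1 := eigs_unique _ h₁ u₁ hu₁ α ha rfl
    have e2 := eigs_unique _ h₂ u₂ hu₂ β hb rfl
    have e3 := eigs_unique _ (h₁.add h₂) u₃ hu₃ δ hd h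
    refine ⟨_, _, h₁, h₂, ?_⟩
    rw [← he]
    refine ⟨?_, ?_, ?_⟩
    · unfold lMap; rw [e1]; rfl
    · unfold lMap; rw [e2]; rfl
    · unfold lMap; rw [e3]; rfl

lemma cont_conj {X : Type*} [TopologicalSpace X] {n : ℕ} {f : X → (Fin n → ℝ)}
    {g : X → Matrix (Fin n) (Fin n) ℂ} (hf : Continuous f) (hg : Continuous g) :
    Continuous (fun x => g x * diagonal (fun a => (f x a : ℂ)) * (g x)ᴴ) := by
  have hd : Continuous (fun x => (diagonal (fun a => (f x a : ℂ)) : Matrix (Fin n) (Fin n) ℂ)) := by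
    apply Continuous.matrix_diagonal
    exact continuous_pi fun a => Complex.continuous_ofReal.comp ((continuous_apply a).comp hf)
  exact (hg.matrix_mul hd).matrix_mul hg.matrix_conjTranspose

lemma hornS_closed (n : ℕ) : IsClosed (HornS n) := by
  have hanti : IsClosed {l : Fin n → ℝ | Antitone l} := by
    have : {l : Fin n → ℝ | Antitone l} = ⋂ (a : Fin n) (b : Fin n) (_ : a ≤ b), {l | l b ≤ l a} := by
      ext l; simp [Antitone]
    rw [this]
    exact isClosed_iInter fun a => isClosed_iInter fun b => isClosed_iInter fun _ =>
      isClosed_le (continuous_apply b) (continuous_apply a)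
  have hT : IsClosed {x : (Fin n → ℝ) × (Fin n → ℝ) × (Fin n → ℝ) | HornT x.1 x.2.1 x.2.2} := by
    let K := {v : Matrix (Fin n) (Fin n) ℂ | vᴴ * v = 1}
    have hK : IsCompact (K ×ˢ K ×ˢ K) := compact_unitary.prod (compact_unitary.prod compact_unitary)
    have hR : IsClosed {p : ((Fin n → ℝ) × (Fin n → ℝ) × (Fin n → ℝ)) ×
        (Matrix (Fin n) (Fin n) ℂ × Matrix (Fin n) (Fin n) ℂ × Matrix (Fin n) (Fin n) ℂ) |
        p.2.1 * diagonal (fun a => (p.1.1 a : ℂ)) * p.2.1ᴴ +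
        p.2.2.1 * diagonal (fun a => (p.1.2.1 a : ℂ)) * p.2.2.1ᴴ =
        p.2.2.2 * diagonal (fun a => (p.1.2.2 a : ℂ)) * p.2.2.2ᴴ} := by
      refine isClosed_eq (Continuous.add ?_ ?_) ?_
      · exact cont_conj (continuous_fst.comp continuous_fst) (continuous_fst.comp continuous_snd)
      · exact cont_conj (continuous_fst.comp (continuous_snd.comp continuous_fst))
          (continuous_fst.comp (continuous_snd.comp continuous_snd))
      · exact cont_conj (continuous_snd.comp (continuous_snd.comp continuous_fst))
          (continuous_snd.comp (continuous_snd.comp continuous_snd))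
    have := closed_exists hK hR
    convert this using 1
    ext x
    constructor
    · rintro ⟨u₁, u₂, u₃, ⟨h1, h2, h3⟩, h⟩
      exact ⟨(u₁, u₂, u₃), ⟨h1, h2, h3⟩, h⟩
    · rintro ⟨⟨u₁, u₂, u₃⟩, ⟨h1, h2, h3⟩, h⟩
      exact ⟨u₁, u₂, u₃, ⟨h1, h2, h3⟩, h⟩
  exact ((hanti.preimage continuous_fst).inter ((hanti.preimage (continuous_fst.comp continuous_snd)).inter
    (hanti.preimage (continuous_snd.comp continuous_snd)))).inter hT

lemma horn_closed (n : ℕ) : IsClosed (HornCone n) := by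
  rw [horn_eq]
  have hinj : Function.Injective ((psum n).prodMap ((psum n).prodMap (psum n))) := by
    rintro ⟨a, b, c⟩ ⟨a', b', c'⟩ h
    have h' : (psum n a, psum n b, psum n c) = (psum n a', psum n b', psum n c') := h
    simp only [Prod.mk.injEq] at h' ⊢
    exact ⟨psum_inj n h'.1, psum_inj n h'.2.1, psum_inj n h'.2.2⟩
  exact (LinearMap.isClosedEmbedding_of_injective (LinearMap.ker_eq_bot.2 hinj)).isClosedMap _ (hornS_closed n)

lemma horn_add (n : ℕ) (hn : 0 < n) : ∀ x ∈ HornCone n, ∀ y ∈ HornCone n, x + y ∈ HornCone n := by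
  rw [horn_eq]
  rintro _ ⟨x, ⟨⟨h1, h2, h3⟩, h⟩, rfl⟩ _ ⟨y, ⟨⟨h1', h2', h3'⟩, h'⟩, rfl⟩
  exact ⟨x + y, ⟨⟨h1.add h1', h2.add h2', h3.add h3'⟩, hornT_add hn _ _ _ _ _ _ h1 h2 h3 h1' h2' h3' h h'⟩,
    map_add _ _ _⟩

lemma horn_smul (n : ℕ) : ∀ c : ℝ, 0 ≤ c → ∀ x ∈ HornCone n, c • x ∈ HornCone n := by
  rw [horn_eq]
  rintro c hc _ ⟨x, ⟨⟨h1, h2, h3⟩, u₁, u₂, u₃, hu, h⟩, rfl⟩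
  have hs : ∀ l : Fin n → ℝ, Antitone l → Antitone (c • l) := fun l hl a b hab =>
    mul_le_mul_of_nonneg_left (hl hab) hc
  have hd : ∀ (l : Fin n → ℝ) (u : Matrix (Fin n) (Fin n) ℂ),
      u * diagonal (fun a => ((c • l) a : ℂ)) * uᴴ = (c : ℂ) • (u * diagonal (fun a => (l a : ℂ)) * uᴴ) := by
    intro l u
    have : diagonal (fun a => ((c • l) a : ℂ)) = (c : ℂ) • diagonal (fun a => (l a : ℂ)) := by
      rw [← diagonal_smul]; congr 1; ext a; simp
    rw [this, Matrix.mul_smul, Matrix.smul_mul]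
  refine ⟨c • x, ⟨⟨hs _ h1, hs _ h2, hs _ h3⟩, u₁, u₂, u₃, hu, ?_⟩, map_smul _ _ _⟩
  change u₁ * diagonal (fun a => ((c • x.1) a : ℂ)) * u₁ᴴ + u₂ * diagonal (fun a => ((c • x.2.1) a : ℂ)) * u₂ᴴ =
    u₃ * diagonal (fun a => ((c • x.2.2) a : ℂ)) * u₃ᴴ
  rw [hd, hd, hd, ← smul_add, h]

end Final

/-- The Horn cone is a closed convex cone: it is closed, stable under addition,
convex, and stable under multiplication by nonnegative scalars. -/
theorem horn_cone_closed_convex_cone (n : ℕ) (hn : 0 < n) :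
    IsClosed (HornCone n) ∧
    (∀ x ∈ HornCone n, ∀ y ∈ HornCone n, x + y ∈ HornCone n) ∧
    Convex ℝ (HornCone n) ∧
    (∀ c : ℝ, 0 ≤ c → ∀ x ∈ HornCone n, c • x ∈ HornCone n) := by
  refine ⟨horn_closed n, horn_add n hn, ?_, horn_smul n⟩
  intro x hx y hy a b ha hb _
  exact horn_add n hn _ (horn_smul n a ha x hx) _ (horn_smul n b hb y hy)
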